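/- arXiv:2509.06020 — 3 statements merged into one kernel-verified Lean document; each statement's English description precedes it below -/
import Mathlib

section
/- Let T > 0 and n ≥ 1. Suppose the flux functions f_i(t,x,u), i = 1,…,n, are C¹ on [0,T]×ℝⁿ×ℝ with continuous mixed derivatives ∂²f_i/∂x_j∂u and ∂²f_i/∂t∂u, and the source term g(t,x,u) is continuous on [0,T]×ℝⁿ×ℝ and right-Lipschitz in u on every compact set. For M, R > 0 set N_M(R) := max over (t,x) ∈ [0,T]×B_R(0) and |w| ≤ M of (Σ_{i=1}^n (∂f_i/∂u(t,x,w))²)^{1/2}, and assume that for every M > 0, N_M(R)/R → 0 as R → ∞. Then the Kruzkov entropy solution of the Cauchy problem u_t + Σ_{i=1}^n ∂_{x_i} f_i(t,x,u) = g(t,x,u), u(0,·) = u₀ on [0,T]×ℝⁿ is unique: any two Kruzkov entropy solutions with the same initial data u₀ ∈ L^∞(ℝⁿ) coincide almost everywhere in [0,T]×ℝⁿ. -/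
open MeasureTheory Set Filter

noncomputable section

/-- Euclidean space `ℝⁿ`. -/
abbrev Euc (n : ℕ) := EuclideanSpace ℝ (Fin n)

/-- A Kruzkov entropy solution of `u_t + ∑ ∂_{x_i} f_i(t,x,u) = g(t,x,u)` on `[0,T] × ℝⁿ`
with initial data `u₀`. -/
def IsEntropySol (n : ℕ) (T : ℝ)
    (f : Fin n → ℝ × Euc n × ℝ → ℝ)
    (g : ℝ × Euc n × ℝ → ℝ)
    (u : ℝ × Euc n → ℝ) (u₀ : Euc n → ℝ) : Prop :=
  Measurable u ∧ (∃ C : ℝ, ∀ p, |u p| ≤ C) ∧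
  (∀ k : ℝ, ∀ φ : ℝ × Euc n → ℝ,
    ContDiff ℝ (⊤ : ℕ∞) φ → HasCompactSupport φ → (∀ p, 0 ≤ φ p) →
    (∀ p : ℝ × Euc n, p.1 ∉ Set.Ioo 0 T → φ p = 0) →
    0 ≤ ∫ p in (Set.Ioo (0:ℝ) T) ×ˢ (Set.univ : Set (Euc n)),
        (|u p - k| * fderiv ℝ φ p (1, 0)
          + ∑ i, Real.sign (u p - k) * (f i (p.1, p.2, u p) - f i (p.1, p.2, k))
              * fderiv ℝ φ p (0, EuclideanSpace.single i 1)
          + Real.sign (u p - k)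
              * (-(∑ i, fderiv ℝ (f i) (p.1, p.2, k) (0, EuclideanSpace.single i 1, 0))
                  + g (p.1, p.2, u p)) * φ p)) ∧
  (∃ Z : Set ℝ, volume Z = 0 ∧ ∀ R : ℝ, 0 < R →
    Tendsto (fun t => ∫ x in Metric.closedBall (0 : Euc n) R, |u (t, x) - u₀ x|)
      (nhdsWithin 0 (Set.Icc 0 T \ Z)) (nhds 0))


section Basics
open Topology

theorem kz_measurable_sign : Measurable Real.sign := by
  unfold Real.sign
  exact Measurable.ite measurableSet_Iio measurable_const
    (Measurable.ite measurableSet_Ioi measurable_const measurable_const)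

theorem kz_abs_sign_le (x : ℝ) : |Real.sign x| ≤ 1 := by
  rcases Real.sign_apply_eq x with h | h | h <;> simp [h]

/-- The sign is harmless in limits when the limit vanishes on the diagonal. -/
theorem kz_tendsto_sign_mul {a b X : ℝ} {ak bk Xk : ℕ → ℝ}
    (ha : Tendsto ak atTop (𝓝 a)) (hb : Tendsto bk atTop (𝓝 b))
    (hX : Tendsto Xk atTop (𝓝 X)) (h0 : a = b → X = 0) :
    Tendsto (fun k => Real.sign (ak k - bk k) * Xk k) atTop (𝓝 (Real.sign (a - b) * X)) := by
  have hd := ha.sub hb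
  rcases lt_trichotomy (a - b) 0 with h | h | h
  · rw [Real.sign_of_neg h]
    have : ∀ᶠ k in atTop, -1 * Xk k = Real.sign (ak k - bk k) * Xk k := by
      filter_upwards [hd.eventually_lt_const h] with k hk
      rw [Real.sign_of_neg hk]
    exact (hX.const_mul (-1)).congr' this
  · have hX0 := h0 (sub_eq_zero.1 h)
    subst hX0
    rw [mul_zero]
    refine squeeze_zero_norm (fun k => ?_) (tendsto_norm_zero.comp hX)
    simp only [norm_mul, Real.norm_eq_abs, Function.comp]
    exact mul_le_of_le_one_left (abs_nonneg _) (kz_abs_sign_le _)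
  · rw [Real.sign_of_pos h]
    have : ∀ᶠ k in atTop, 1 * Xk k = Real.sign (ak k - bk k) * Xk k := by
      filter_upwards [hd.eventually_const_lt h] with k hk
      rw [Real.sign_of_pos hk]
    exact (hX.const_mul 1).congr' this

variable {X : Type*} [TopologicalSpace X] [T2Space X] [MeasurableSpace X] [BorelSpace X]
  [SecondCountableTopology X]

/-- Integrability of bounded, compactly supported expressions. -/
theorem kz_integrable (μ : Measure X) [IsFiniteMeasureOnCompacts μ] {K : Set X} (hK : IsCompact K)
    (J : X × ℝ × ℝ → ℝ) (hJ : Continuous J) (hJ0 : ∀ x ∉ K, ∀ a b, J (x, a, b) = 0)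
    {U V : X → ℝ} (hU : Measurable U) (hV : Measurable V) {M : ℝ} (hUM : ∀ x, |U x| ≤ M)
    (hVM : ∀ x, |V x| ≤ M) :
    Integrable (fun x => Real.sign (U x - V x) * J (x, U x, V x)) μ := by
  obtain ⟨C, hC⟩ := (hK.prod (isCompact_Icc.prod isCompact_Icc :
    IsCompact (Icc (-M) M ×ˢ Icc (-M) M))).exists_bound_of_continuousOn hJ.continuousOn
  have hmeas : Measurable (fun x => Real.sign (U x - V x) * J (x, U x, V x)) :=
    (kz_measurable_sign.comp (hU.sub hV)).mul
      (hJ.measurable.comp (measurable_id.prodMk (hU.prodMk hV)))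
  have hon : IntegrableOn (fun x => Real.sign (U x - V x) * J (x, U x, V x)) K μ := by
    refine IntegrableOn.of_bound hK.measure_lt_top hmeas.aestronglyMeasurable C ?_
    refine (ae_restrict_mem hK.measurableSet).mono fun x hx => ?_
    rw [norm_mul]
    refine (mul_le_of_le_one_left (norm_nonneg _) (kz_abs_sign_le _)).trans
      (hC (x, U x, V x) ⟨hx, abs_le.1 (hUM x), abs_le.1 (hVM x)⟩)
  refine (integrableOn_iff_integrable_of_support_subset ?_).1 hon
  intro x hx
  by_contra h
  exact hx (by simp [hJ0 x h])

/-- Dominated convergence for sign-type integrands. -/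
theorem kz_dct (μ : Measure X) [IsFiniteMeasureOnCompacts μ] {K : Set X} (hK : IsCompact K)
    (J : ℝ × X × ℝ × ℝ → ℝ) (hJ : Continuous J)
    (hJ0 : ∀ h, ∀ x ∉ K, ∀ a b, J (h, x, a, b) = 0)
    (hJd : ∀ x a, J (0, x, a, a) = 0)
    {U V : X → ℝ} {Vk : ℕ → X → ℝ} (hU : Measurable U) (hVk : ∀ k, Measurable (Vk k))
    {M : ℝ} (hUM : ∀ x, |U x| ≤ M) (hVM : ∀ k x, |Vk k x| ≤ M)
    {h : ℕ → ℝ} (hh : ∀ k, h k ∈ Icc (0 : ℝ) 1) (hh0 : Tendsto h atTop (𝓝 0))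
    (hconv : ∀ᵐ x ∂μ, x ∈ K → Tendsto (fun k => Vk k x) atTop (𝓝 (V x))) :
    Tendsto (fun k => ∫ x, Real.sign (U x - Vk k x) * J (h k, x, U x, Vk k x) ∂μ) atTop
      (𝓝 (∫ x, Real.sign (U x - V x) * J (0, x, U x, V x) ∂μ)) := by
  obtain ⟨C, hC⟩ := ((isCompact_Icc : IsCompact (Icc (0:ℝ) 1)).prod
    (hK.prod (isCompact_Icc.prod isCompact_Icc :
    IsCompact (Icc (-M) M ×ˢ Icc (-M) M)))).exists_bound_of_continuousOn hJ.continuousOn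
  refine tendsto_integral_of_dominated_convergence (K.indicator fun _ => C) ?_ ?_ ?_ ?_
  · intro k
    exact ((kz_measurable_sign.comp (hU.sub (hVk k))).mul
      (hJ.measurable.comp (measurable_const.prodMk
        (measurable_id.prodMk (hU.prodMk (hVk k)))))).aestronglyMeasurable
  · exact (integrable_indicator_iff hK.measurableSet).2 (integrableOn_const hK.measure_ne_top)
  · intro k
    refine Eventually.of_forall fun x => ?_
    by_cases hx : x ∈ K
    · rw [indicator_of_mem hx, norm_mul]
      exact (mul_le_of_le_one_left (norm_nonneg _) (kz_abs_sign_le _)).trans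
        (hC (h k, x, U x, Vk k x) ⟨hh k, hx, abs_le.1 (hUM x), abs_le.1 (hVM k x)⟩)
    · simp [indicator_of_notMem hx, hJ0 _ x hx]
  · filter_upwards [hconv] with x hx
    by_cases hxK : x ∈ K
    · refine kz_tendsto_sign_mul tendsto_const_nhds (hx hxK) ?_ ?_
      · exact (hJ.tendsto (0, x, U x, V x)).comp (hh0.prodMk_nhds (tendsto_const_nhds.prodMk_nhds
          (tendsto_const_nhds.prodMk_nhds (hx hxK))))
      · intro e
        rw [← e]; exact hJd _ _
    · simp [hJ0 _ x hxK]

end Basics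

section AeConv
open Topology

variable {E : Type*} [NormedAddCommGroup E] [NormedSpace ℝ E] [FiniteDimensional ℝ E]
  [MeasurableSpace E] [BorelSpace E]

/-- change of variables `q = p - h z`. -/
theorem kz_change (μ : Measure E) [μ.IsAddHaarMeasure] (F : E → ℝ) (p : E) (h : ℝ) :
    ∫ z, F (p - h • z) ∂μ = |(h ^ Module.finrank ℝ E)⁻¹| * ∫ q, F q ∂μ := by
  rw [Measure.integral_comp_smul μ (fun y => F (p - y)) h, integral_sub_left_eq_self, smul_eq_mul]

theorem kz_lebesgue (μ : Measure E) [μ.IsAddHaarMeasure] {v : E → ℝ} (hv : Measurable v) {M : ℝ}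
    (hM : ∀ p, |v p| ≤ M) {r : ℝ} (hr : 0 < r) {h : ℕ → ℝ} (hh : ∀ k, 0 < h k)
    (hh0 : Tendsto h atTop (𝓝 0)) :
    ∀ᵐ p ∂μ, Tendsto (fun k => ∫ z in Metric.closedBall (0 : E) r, |v (p - h k • z) - v p| ∂μ)
      atTop (𝓝 0) := by
  have hli : LocallyIntegrable v μ := by
    intro x
    refine ⟨Metric.ball x 1, Metric.ball_mem_nhds _ one_pos, ?_⟩
    exact IntegrableOn.of_bound Metric.isBounded_ball.measure_lt_top hv.aestronglyMeasurable M
      (Eventually.of_forall hM)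
  filter_upwards [IsUnifLocDoublingMeasure.ae_tendsto_average_norm_sub μ hli 1] with p hp
  have h1 := hp (l := atTop) (fun _ : ℕ => p) (fun k => h k * r)
    (tendsto_nhdsWithin_iff.2 ⟨by simpa using hh0.mul_const r,
      Eventually.of_forall fun k => mul_pos (hh k) hr⟩)
    (Eventually.of_forall fun k => by
      simpa using (mul_pos (hh k) hr).le)
  have h2 := h1.const_mul (μ.real (Metric.closedBall (0:E) r))
  rw [mul_zero] at h2
  refine h2.congr fun k => ?_
  have hk := hh k
  rw [setAverage_eq, smul_eq_mul]
  have e1 : ∫ z in Metric.closedBall (0 : E) r, |v (p - h k • z) - v p| ∂μ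
      = ∫ z, (Metric.closedBall p (h k * r)).indicator (fun q => |v q - v p|) (p - h k • z) ∂μ := by
    rw [← integral_indicator measurableSet_closedBall]
    congr 1
    ext z
    by_cases hz : z ∈ Metric.closedBall (0:E) r
    · rw [indicator_of_mem hz, indicator_of_mem]
      simp only [mem_closedBall_iff_norm, sub_zero, sub_sub_cancel_left, norm_neg, norm_smul,
        Real.norm_eq_abs, abs_of_pos hk] at hz ⊢
      exact mul_le_mul_of_nonneg_left hz hk.le
    · rw [indicator_of_notMem hz, indicator_of_notMem]
      simp only [mem_closedBall_iff_norm, sub_zero, sub_sub_cancel_left, norm_neg, norm_smul,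
        Real.norm_eq_abs, abs_of_pos hk] at hz ⊢
      exact fun hc => hz (le_of_mul_le_mul_left hc hk)
  rw [e1, kz_change, integral_indicator measurableSet_closedBall]
  have e2 : μ.real (Metric.closedBall p (h k * r))
      = h k ^ Module.finrank ℝ E * μ.real (Metric.closedBall (0:E) r) := by
    simp only [Measure.real]
    rw [Measure.addHaar_closedBall_mul μ p hk.le hr.le, ENNReal.toReal_mul,
      ENNReal.toReal_ofReal (by positivity)]
  rw [e2]
  have hpos : 0 < μ.real (Metric.closedBall (0:E) r) :=
    ENNReal.toReal_pos (Metric.measure_closedBall_pos μ 0 hr).ne'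
      (isCompact_closedBall _ _).measure_ne_top
  have hpp : 0 < h k ^ Module.finrank ℝ E := by positivity
  rw [abs_of_pos (inv_pos.2 hpp)]
  simp only [Real.norm_eq_abs]
  field_simp

theorem kz_ae_conv (μ : Measure E) [μ.IsAddHaarMeasure] {v : E → ℝ} (hv : Measurable v) {M : ℝ}
    (hM : ∀ p, |v p| ≤ M) {r : ℝ} (hr : 0 < r) {δ : ℝ} (hδ : 0 < δ) :
    ∃ h : ℕ → ℝ, (∀ k, 0 < h k ∧ h k ≤ 1 ∧ h k < δ) ∧ Tendsto h atTop (𝓝 0) ∧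
      ∀ᵐ x ∂(μ.prod μ), x ∈ Metric.closedBall (0:E) r ×ˢ Metric.closedBall (0:E) r →
        Tendsto (fun k => v (x.1 - h k • x.2)) atTop (𝓝 (v x.1)) := by
  set B := Metric.closedBall (0:E) r
  set d := min 1 (δ/2) with hd
  have hd0 : 0 < d := by positivity
  set h : ℕ → ℝ := fun k => d * (1 / ((k:ℝ) + 1)) with hdef
  have hpos : ∀ k, 0 < h k := fun k => by positivity
  have hled : ∀ k, h k ≤ d := fun k => by
    refine mul_le_of_le_one_right hd0.le ?_
    rw [div_le_one (by positivity)]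
    linarith [(Nat.cast_nonneg k : (0:ℝ) ≤ k)]
  have hh0 : Tendsto h atTop (𝓝 0) := by
    simpa [hdef] using (tendsto_one_div_add_atTop_nhds_zero_nat (𝕜 := ℝ)).const_mul d
  have : IsFiniteMeasure (μ.restrict B) := ⟨by
    simpa using (isCompact_closedBall (0:E) r).measure_lt_top⟩
  have hM0 : 0 ≤ M := (abs_nonneg _).trans (hM 0)
  have hmeas : ∀ k, Measurable (fun x : E × E => v (x.1 - h k • x.2)) := fun k =>
    hv.comp (measurable_fst.sub (measurable_snd.const_smul _))
  have hbd : ∀ k (x : E × E), |v (x.1 - h k • x.2) - v x.1| ≤ 2 * M := fun k x => by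
    refine (abs_sub _ _).trans ?_
    linarith [hM (x.1 - h k • x.2), hM x.1]
  have hIntg : ∀ k, Integrable (fun x : E × E => |v (x.1 - h k • x.2) - v x.1|)
      ((μ.restrict B).prod (μ.restrict B)) := fun k =>
    Integrable.of_bound ((hmeas k).sub (hv.comp measurable_fst)).abs.aestronglyMeasurable (2*M)
      (Eventually.of_forall fun x => by
        simpa using hbd k x)
  have hL1 : Tendsto (fun k => ∫ x, |v (x.1 - h k • x.2) - v x.1|
      ∂((μ.restrict B).prod (μ.restrict B))) atTop (𝓝 0) := by
    have : ∀ k, ∫ x, |v (x.1 - h k • x.2) - v x.1| ∂((μ.restrict B).prod (μ.restrict B))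
        = ∫ p, (∫ z in B, |v (p - h k • z) - v p| ∂μ) ∂(μ.restrict B) := fun k =>
      integral_prod _ (hIntg k)
    simp only [this]
    rw [show (0:ℝ) = ∫ p, (0:ℝ) ∂(μ.restrict B) by simp]
    refine tendsto_integral_of_dominated_convergence (fun _ => 2 * M * μ.real B) ?_ ?_ ?_ ?_
    · intro k
      exact (hIntg k).integral_prod_left.aestronglyMeasurable
    · exact integrable_const _
    · intro k
      refine Eventually.of_forall fun p => ?_
      refine (norm_setIntegral_le_of_norm_le_const (C := 2 * M)
        (isCompact_closedBall (0:E) r).measure_lt_top (fun z _ => ?_))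
      simpa using hbd k (p, z)
    · exact ae_restrict_of_ae (kz_lebesgue μ hv hM hr hpos hh0)
  have hTM : TendstoInMeasure ((μ.restrict B).prod (μ.restrict B))
      (fun k (x : E × E) => v (x.1 - h k • x.2)) atTop (fun x => v x.1) := by
    refine tendstoInMeasure_of_tendsto_eLpNorm one_ne_zero
      (fun k => (hmeas k).aestronglyMeasurable) (hv.comp measurable_fst).aestronglyMeasurable ?_
    have : ∀ k, eLpNorm ((fun (x : E × E) => v (x.1 - h k • x.2)) - fun x => v x.1) 1
        ((μ.restrict B).prod (μ.restrict B)) = ENNReal.ofReal (∫ x, |v (x.1 - h k • x.2) - v x.1|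
      ∂((μ.restrict B).prod (μ.restrict B))) := by
      intro k
      rw [eLpNorm_one_eq_lintegral_enorm, ofReal_integral_eq_lintegral_ofReal (hIntg k)
        (Eventually.of_forall fun _ => abs_nonneg _)]
      refine lintegral_congr fun x => ?_
      exact Real.enorm_eq_ofReal_abs _
    simp only [this]
    simpa using ENNReal.tendsto_ofReal hL1
  obtain ⟨ns, hns, hae⟩ := hTM.exists_seq_tendsto_ae
  refine ⟨fun k => h (ns k), fun k => ⟨hpos _, (hled _).trans (min_le_left _ _), ?_⟩,
    hh0.comp hns.tendsto_atTop, ?_⟩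
  · have : d ≤ δ/2 := min_le_right _ _
    linarith [hled (ns k)]
  · rw [Measure.prod_restrict] at hae
    exact (ae_restrict_iff' (measurableSet_closedBall.prod measurableSet_closedBall)).1 hae

end AeConv

section Kato
open Topology
open scoped ContDiff

variable {E : Type*} [NormedAddCommGroup E] [NormedSpace ℝ E]

/-- difference quotients of `C¹` functions extend continuously. -/
theorem kz_quot {A : E × ℝ → ℝ} (hA : ContDiff ℝ 1 A) :
    ∃ Q : ℝ × (E × E) × ℝ → ℝ, Continuous Q ∧
      (∀ h p z a, h * Q (h, (p, z), a) = A (p, a) - A (p - h • z, a)) ∧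
      (∀ p z a, Q (0, (p, z), a) = fderiv ℝ A (p, a) (z, 0)) := by
  have hd : Continuous (fderiv ℝ A) := hA.continuous_fderiv one_ne_zero
  refine ⟨fun y => ∫ s in (0:ℝ)..1, fderiv ℝ A (y.2.1.1 - (s * y.1) • y.2.1.2, y.2.2)
    (y.2.1.2, 0), ?_, ?_, ?_⟩
  · refine intervalIntegral.continuous_parametric_intervalIntegral_of_continuous' ?_ _ _
    have h1 : Continuous fun y : (ℝ × (E × E) × ℝ) × ℝ =>
        fderiv ℝ A (y.1.2.1.1 - (y.2 * y.1.1) • y.1.2.1.2, y.1.2.2) := hd.comp (by fun_prop)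
    exact h1.clm_apply (by fun_prop)
  · intro h p z a
    have key : ∀ s : ℝ, HasDerivAt (fun s : ℝ => A (p - (s * h) • z, a))
        (-(h * fderiv ℝ A (p - (s * h) • z, a) (z, 0))) s := by
      intro s
      have h1 : HasDerivAt (fun s : ℝ => (p - (s * h) • z, a)) (-(h • z), (0:ℝ)) s := by
        refine HasDerivAt.prodMk ?_ (hasDerivAt_const _ _)
        have := (((hasDerivAt_id s).mul_const h).smul_const z).const_sub p
        simpa using this
      have h2 := ((hA.differentiable one_ne_zero) (p - (s * h) • z, a)).hasFDerivAt.comp_hasDerivAt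
        s h1
      have h3 : ((-(h • z), (0:ℝ)) : E × ℝ) = (-h) • (z, (0:ℝ)) := by
        ext <;> simp
      rw [h3, map_smul, smul_eq_mul, neg_mul] at h2
      exact h2
    have hc : Continuous fun s : ℝ => fderiv ℝ A (p - (s * h) • z, a) (z, 0) :=
      (hd.comp (by fun_prop)).clm_apply continuous_const
    have := intervalIntegral.integral_eq_sub_of_hasDerivAt (a := 0) (b := 1)
      (fun s _ => key s) ((continuous_const.mul hc).neg.intervalIntegrable _ _)
    rw [intervalIntegral.integral_neg, intervalIntegral.integral_const_mul] at this
    simp only [one_mul, zero_mul, zero_smul, sub_zero] at this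
    linarith
  · intro p z a
    simp

variable [MeasurableSpace E] {ι : Type*} [Fintype ι]

/-- abstract entropy inequality. -/
def KzEnt (μ : Measure E) (Q : Set E) (e : ι → E) (A : ι → E × ℝ → ℝ) (g : E × ℝ → ℝ)
    (u : E → ℝ) : Prop :=
  ∀ (k : ℝ) (φ : E → ℝ), ContDiff ℝ (⊤ : ℕ∞) φ → HasCompactSupport φ → (∀ p, 0 ≤ φ p) →
    tsupport φ ⊆ Q →
    0 ≤ ∫ p, Real.sign (u p - k) * (∑ i, (A i (p, u p) - A i (p, k)) * fderiv ℝ φ p (e i)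
      + (-(∑ i, fderiv ℝ (A i) (p, k) (e i, 0)) + g (p, u p)) * φ p) ∂μ

variable [FiniteDimensional ℝ E] [BorelSpace E]

theorem kz_fderiv_zero {φ : E → ℝ} {p : E} (hp : p ∉ tsupport φ) : fderiv ℝ φ p = 0 := by
  have := (notMem_tsupport_iff_eventuallyEq.1 hp)
  rw [this.fderiv_eq]; simp

theorem kz_doubling (μ : Measure E) [μ.IsAddHaarMeasure] {Q : Set E} {e : ι → E}
    {A : ι → E × ℝ → ℝ} {g : E × ℝ → ℝ} (hA : ∀ i, ContDiff ℝ 1 (A i)) (hg : Continuous g)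
    {u v : E → ℝ} (hu : KzEnt μ Q e A g u) (hv : KzEnt μ Q e A g v)
    (hum : Measurable u) (hvm : Measurable v) {M : ℝ} (huM : ∀ p, |u p| ≤ M)
    (hvM : ∀ p, |v p| ≤ M) {ψ ρ : E → ℝ} (hψ : ContDiff ℝ (⊤ : ℕ∞) ψ) (hψc : HasCompactSupport ψ)
    (hψ0 : ∀ p, 0 ≤ ψ p) (hψQ : tsupport ψ ⊆ Q)
    (hρ : ContDiff ℝ (⊤ : ℕ∞) ρ) (hρs : tsupport ρ ⊆ Metric.closedBall 0 1) (hρ0 : ∀ p, 0 ≤ ρ p)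
    {Qf : ι → ℝ × (E × E) × ℝ → ℝ} (hQc : ∀ i, Continuous (Qf i))
    (hQ : ∀ i h p z a, h * Qf i (h, (p, z), a) = A i (p, a) - A i (p - h • z, a))
    {h : ℝ} (hh : 0 < h) (hhQ : ∀ p ∈ tsupport ψ, ∀ q, dist q p ≤ h → q ∈ Q)
    (J : ℝ × (E × E) × ℝ × ℝ → ℝ) (hJ : Continuous J)
    (hJ0 : ∀ h, ∀ x ∉ tsupport ψ ×ˢ Metric.closedBall (0:E) 1, ∀ a b, J (h, x, a, b) = 0)
    (hJdef : ∀ h p z a b, J (h, (p, z), a, b) =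
      ∑ i, ((A i (p, a) - A i (p, b)) * (fderiv ℝ ψ p (e i) * ρ z)
        + ψ p * fderiv ℝ ρ z (e i) * (Qf i (h, (p, z), a) - Qf i (h, (p, z), b)))
      + (-(∑ i, fderiv ℝ (A i) (p, b) (e i, 0)) + (∑ i, fderiv ℝ (A i) (p - h • z, a) (e i, 0))
        + g (p, a) - g (p - h • z, b)) * (ψ p * ρ z)) :
    0 ≤ ∫ x : E × E, Real.sign (u x.1 - v (x.1 - h • x.2)) *
      J (h, x, u x.1, v (x.1 - h • x.2)) ∂(μ.prod μ) := by
  have hh0 : h ≠ 0 := hh.ne'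
  have hKψ : IsCompact (tsupport ψ) := hψc
  have hKB : IsCompact (Metric.closedBall (0:E) 1) := isCompact_closedBall _ _
  set w : E × E → E := fun x => h⁻¹ • (x.1 - x.2) with hw
  have hwc : Continuous w := by fun_prop
  set K2 : Set (E × E) := Set.image (fun y : E × E => (y.1, y.1 - h • y.2))
    (tsupport ψ ×ˢ Metric.closedBall (0:E) 1) with hK2
  have hK2c : IsCompact K2 := (hKψ.prod hKB).image (by fun_prop)
  have hoff : ∀ x : E × E, x ∉ K2 → x.1 ∉ tsupport ψ ∨ w x ∉ tsupport ρ := by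
    intro x hx
    by_contra hc
    push Not at hc
    refine hx ⟨(x.1, w x), ⟨hc.1, hρs hc.2⟩, ?_⟩
    ext <;> simp [hw, smul_smul, hh0]
  have hρd : Differentiable ℝ ρ := hρ.differentiable (by simp)
  have hψd : Differentiable ℝ ψ := hψ.differentiable (by simp)
  have hdψ : Continuous (fderiv ℝ ψ) := hψ.continuous_fderiv (by simp)
  have hdρ : Continuous (fderiv ℝ ρ) := hρ.continuous_fderiv (by simp)
  have hdA : ∀ i, Continuous (fderiv ℝ (A i)) := fun i => (hA i).continuous_fderiv one_ne_zero
  have hAc : ∀ i, Continuous (A i) := fun i => (hA i).continuous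
  -- the two doubled integrands
  set Ψ1 : (E × E) × ℝ × ℝ → ℝ := fun y =>
    ∑ i, (A i (y.1.1, y.2.1) - A i (y.1.1, y.2.2)) *
        (fderiv ℝ ψ y.1.1 (e i) * ρ (w y.1) + ψ y.1.1 * (h⁻¹ * fderiv ℝ ρ (w y.1) (e i)))
      + (-(∑ i, fderiv ℝ (A i) (y.1.1, y.2.2) (e i, 0)) + g (y.1.1, y.2.1)) *
        (ψ y.1.1 * ρ (w y.1)) with hΨ1
  set Ψ2 : (E × E) × ℝ × ℝ → ℝ := fun y =>
    ∑ i, (A i (y.1.2, y.2.1) - A i (y.1.2, y.2.2)) *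
        (-(ψ y.1.1 * (h⁻¹ * fderiv ℝ ρ (w y.1) (e i))))
      + ((∑ i, fderiv ℝ (A i) (y.1.2, y.2.1) (e i, 0)) - g (y.1.2, y.2.2)) *
        (ψ y.1.1 * ρ (w y.1)) with hΨ2
  have hψcont := hψ.continuous
  have hρcont := hρ.continuous
  have c1 : Continuous Ψ1 := by
    rw [hΨ1]
    have a1 : ∀ i, Continuous fun y : (E × E) × ℝ × ℝ => fderiv ℝ ψ y.1.1 (e i) := fun i =>
      (hdψ.comp (by fun_prop)).clm_apply continuous_const
    have a2 : ∀ i, Continuous fun y : (E × E) × ℝ × ℝ => fderiv ℝ ρ (w y.1) (e i) := fun i =>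
      (hdρ.comp (by fun_prop)).clm_apply continuous_const
    have a3 : ∀ i, Continuous fun y : (E × E) × ℝ × ℝ =>
        fderiv ℝ (A i) (y.1.1, y.2.2) (e i, 0) := fun i =>
      ((hdA i).comp (by fun_prop)).clm_apply continuous_const
    fun_prop
  have c2 : Continuous Ψ2 := by
    rw [hΨ2]
    have a2 : ∀ i, Continuous fun y : (E × E) × ℝ × ℝ => fderiv ℝ ρ (w y.1) (e i) := fun i =>
      (hdρ.comp (by fun_prop)).clm_apply continuous_const
    have a3 : ∀ i, Continuous fun y : (E × E) × ℝ × ℝ =>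
        fderiv ℝ (A i) (y.1.2, y.2.1) (e i, 0) := fun i =>
      ((hdA i).comp (by fun_prop)).clm_apply continuous_const
    fun_prop
  have z1 : ∀ x ∉ K2, ∀ a b, Ψ1 (x, a, b) = 0 := by
    intro x hx a b
    rcases hoff x hx with h1 | h1
    · simp [hΨ1, kz_fderiv_zero h1, image_eq_zero_of_notMem_tsupport h1]
    · simp [hΨ1, kz_fderiv_zero h1, image_eq_zero_of_notMem_tsupport h1]
  have z2 : ∀ x ∉ K2, ∀ a b, Ψ2 (x, a, b) = 0 := by
    intro x hx a b
    rcases hoff x hx with h1 | h1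
    · simp [hΨ2, image_eq_zero_of_notMem_tsupport h1]
    · simp [hΨ2, kz_fderiv_zero h1, image_eq_zero_of_notMem_tsupport h1]
  have hU : Measurable fun x : E × E => u x.1 := hum.comp measurable_fst
  have hV : Measurable fun x : E × E => v x.2 := hvm.comp measurable_snd
  have i1 := kz_integrable (μ.prod μ) hK2c Ψ1 c1 z1 hU hV (fun x => huM x.1) (fun x => hvM x.2)
  have i2 := kz_integrable (μ.prod μ) hK2c Ψ2 c2 z2 hU hV (fun x => huM x.1) (fun x => hvM x.2)
  have p1 : 0 ≤ ∫ x : E × E, Real.sign (u x.1 - v x.2) * Ψ1 (x, u x.1, v x.2) ∂(μ.prod μ) := by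
    rw [integral_prod_symm _ i1]
    refine integral_nonneg fun q => ?_
    have hφ : ContDiff ℝ (⊤ : ℕ∞) (fun p => ψ p * ρ (h⁻¹ • (p - q))) :=
      hψ.mul (hρ.comp (by fun_prop))
    have hsub : tsupport (fun p => ψ p * ρ (h⁻¹ • (p - q))) ⊆ tsupport ψ :=
      tsupport_mul_subset_left
    have := hu (v q) _ hφ (HasCompactSupport.mul_right hψc)
      (fun p => mul_nonneg (hψ0 _) (hρ0 _)) (hsub.trans hψQ)
    refine this.trans_eq (integral_congr_ae (Eventually.of_forall fun p => ?_))
    have hder : ∀ i, fderiv ℝ (fun p => ψ p * ρ (h⁻¹ • (p - q))) p (e i)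
        = fderiv ℝ ψ p (e i) * ρ (h⁻¹ • (p - q))
          + ψ p * (h⁻¹ * fderiv ℝ ρ (h⁻¹ • (p - q)) (e i)) := by
      intro i
      have d1 : HasFDerivAt (fun p : E => h⁻¹ • (p - q)) (h⁻¹ • ContinuousLinearMap.id ℝ E) p :=
        ((hasFDerivAt_id p).sub_const q).const_smul h⁻¹
      have d2 := (hρd (h⁻¹ • (p - q))).hasFDerivAt.comp p d1
      have d3 := (hψd p).hasFDerivAt.mul d2
      have d4 := d3.fderiv
      simp only [Function.comp_def] at d4
      have d5 := congrArg (fun L : E →L[ℝ] ℝ => L (e i)) d4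
      refine d5.trans ?_
      simp
      ring
    simp only [hder, hΨ1, hw]
  have p2 : 0 ≤ ∫ x : E × E, Real.sign (u x.1 - v x.2) * Ψ2 (x, u x.1, v x.2) ∂(μ.prod μ) := by
    rw [integral_prod _ i2]
    refine integral_nonneg fun p => ?_
    have hφ : ContDiff ℝ (⊤ : ℕ∞) (fun q => ψ p * ρ (h⁻¹ • (p - q))) :=
      contDiff_const.mul (hρ.comp (by fun_prop))
    have hsub0 : Function.support (fun q => ψ p * ρ (h⁻¹ • (p - q))) ⊆ Metric.closedBall p h := by
      intro q hq
      have h1 : ρ (h⁻¹ • (p - q)) ≠ 0 := fun hc => hq (by simp [hc])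
      have h2 := hρs (subset_tsupport _ h1)
      rw [mem_closedBall_iff_norm, sub_zero, norm_smul, norm_inv, Real.norm_eq_abs,
        abs_of_pos hh, inv_mul_le_iff₀ hh, mul_one] at h2
      rwa [mem_closedBall_iff_norm, norm_sub_rev]
    have hsub : tsupport (fun q => ψ p * ρ (h⁻¹ • (p - q))) ⊆ Metric.closedBall p h :=
      closure_minimal hsub0 Metric.isClosed_closedBall
    have hcs : HasCompactSupport (fun q => ψ p * ρ (h⁻¹ • (p - q))) :=
      HasCompactSupport.of_support_subset_isCompact (isCompact_closedBall p h) hsub0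
    have hinQ : tsupport (fun q => ψ p * ρ (h⁻¹ • (p - q))) ⊆ Q := by
      by_cases hp : p ∈ tsupport ψ
      · exact fun q hq => hhQ p hp q (hsub hq)
      · have : (fun q => ψ p * ρ (h⁻¹ • (p - q))) = 0 := by
          ext q; simp [image_eq_zero_of_notMem_tsupport hp]
        rw [this]; simp [tsupport]
    have := hv (u p) _ hφ hcs (fun q => mul_nonneg (hψ0 _) (hρ0 _)) hinQ
    refine this.trans_eq (integral_congr_ae (Eventually.of_forall fun q => ?_))
    have hder : ∀ i, fderiv ℝ (fun q => ψ p * ρ (h⁻¹ • (p - q))) q (e i)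
        = -(ψ p * (h⁻¹ * fderiv ℝ ρ (h⁻¹ • (p - q)) (e i))) := by
      intro i
      have d1 : HasFDerivAt (fun q : E => h⁻¹ • (p - q)) (h⁻¹ • -ContinuousLinearMap.id ℝ E) q :=
        ((hasFDerivAt_id q).const_sub p).const_smul h⁻¹
      have d2 := ((hρd (h⁻¹ • (p - q))).hasFDerivAt.comp q d1).const_mul (ψ p)
      have d4 := d2.fderiv
      simp only [Function.comp_def] at d4
      have d5 := congrArg (fun L : E →L[ℝ] ℝ => L (e i)) d4
      refine d5.trans ?_
      simp
    simp only [hder, hΨ2, hw]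
    rw [show v q - u p = -(u p - v q) by ring, Real.sign_neg, neg_mul, ← mul_neg]
    congr 1
    rw [neg_add, ← Finset.sum_neg_distrib]
    congr 1
    · refine Finset.sum_congr rfl fun i _ => by ring
    · ring
  have i3 := i1.add i2
  have p3 : 0 ≤ ∫ x : E × E, (Real.sign (u x.1 - v x.2) * Ψ1 (x, u x.1, v x.2) +
      Real.sign (u x.1 - v x.2) * Ψ2 (x, u x.1, v x.2)) ∂(μ.prod μ) := by
    rw [integral_add i1 i2]; exact add_nonneg p1 p2
  have i4 := kz_integrable (μ.prod μ) (hKψ.prod hKB) (fun y => J (h, y))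
    (hJ.comp (by fun_prop)) (hJ0 h) hU (V := fun x : E × E => v (x.1 - h • x.2))
    (hvm.comp (measurable_fst.sub (measurable_snd.const_smul _))) (fun x => huM x.1)
    (fun x => hvM _)
  rw [integral_prod _ i4]
  have e1 : ∀ p, ∫ z, Real.sign (u p - v (p - h • z)) * J (h, (p, z), u p, v (p - h • z)) ∂μ
      = |(h ^ Module.finrank ℝ E)⁻¹| * ∫ q, (Real.sign (u p - v q) * Ψ1 ((p, q), u p, v q) +
      Real.sign (u p - v q) * Ψ2 ((p, q), u p, v q)) ∂μ := by
    intro p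
    rw [← kz_change μ (fun q => Real.sign (u p - v q) * Ψ1 ((p, q), u p, v q) +
      Real.sign (u p - v q) * Ψ2 ((p, q), u p, v q)) p h]
    refine integral_congr_ae (Eventually.of_forall fun z => ?_)
    simp only
    rw [← mul_add]
    congr 1
    rw [hJdef]
    have hwz : w (p, p - h • z) = z := by simp [hw, smul_smul, hh0]
    simp only [hΨ1, hΨ2, hwz]
    have hs : ∀ i, (A i (p, u p) - A i (p, v (p - h • z))) * (fderiv ℝ ψ p (e i) * ρ z)
        + ψ p * fderiv ℝ ρ z (e i) *
          (Qf i (h, (p, z), u p) - Qf i (h, (p, z), v (p - h • z)))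
        = (A i (p, u p) - A i (p, v (p - h • z))) *
            (fderiv ℝ ψ p (e i) * ρ z + ψ p * (h⁻¹ * fderiv ℝ ρ z (e i)))
          + (A i (p - h • z, u p) - A i (p - h • z, v (p - h • z))) *
            (-(ψ p * (h⁻¹ * fderiv ℝ ρ z (e i)))) := by
      intro i
      have q1 : Qf i (h, (p, z), u p) = h⁻¹ * (A i (p, u p) - A i (p - h • z, u p)) := by
        rw [← hQ]; field_simp
      have q2 : Qf i (h, (p, z), v (p - h • z))
          = h⁻¹ * (A i (p, v (p - h • z)) - A i (p - h • z, v (p - h • z))) := by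
        rw [← hQ]; field_simp
      rw [q1, q2]; ring
    rw [Finset.sum_congr rfl (fun i _ => hs i), Finset.sum_add_distrib]
    ring
  simp only [e1]
  rw [integral_const_mul]
  refine mul_nonneg (abs_nonneg _) ?_
  exact p3.trans_eq (integral_prod _ i3)

theorem kz_ibp (μ : Measure E) [μ.IsAddHaarMeasure] {ρ : E → ℝ} (hρ : ContDiff ℝ (⊤ : ℕ∞) ρ)
    (hρc : HasCompactSupport ρ) (L : E →L[ℝ] ℝ) (e : E) :
    Integrable (fun z => fderiv ℝ ρ z e * L z) μ ∧
    ∫ z, fderiv ℝ ρ z e * L z ∂μ = -(L e * ∫ z, ρ z ∂μ) := by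
  have hdρ : Continuous (fun z => fderiv ℝ ρ z e) :=
    (hρ.continuous_fderiv (by simp)).clm_apply continuous_const
  have hdc : HasCompactSupport (fun z => fderiv ℝ ρ z e) := hρc.fderiv_apply ℝ e
  have hIntg : Integrable (fun z => fderiv ℝ ρ z e * L z) μ :=
    (hdρ.mul L.continuous).integrable_of_hasCompactSupport hdc.mul_right
  refine ⟨hIntg, ?_⟩
  have := integral_mul_fderiv_eq_neg_fderiv_mul_of_integrable (μ := μ) (f := L) (g := ρ) (v := e)
    (by
      simp only [ContinuousLinearMap.fderiv]
      exact (hρ.continuous.integrable_of_hasCompactSupport hρc).const_mul _)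
    (by simpa only [mul_comm] using hIntg)
    ((L.continuous.mul hρ.continuous).integrable_of_hasCompactSupport hρc.mul_left)
    (fun x _ => L.differentiableAt) (fun x _ => hρ.differentiable (by simp) x)
  simp only [ContinuousLinearMap.fderiv] at this
  rw [integral_const_mul] at this
  rw [← this]
  simp only [mul_comm]

/-- Kato inequality. -/
theorem kz_kato (μ : Measure E) [μ.IsAddHaarMeasure] {Q : Set E} (hQo : IsOpen Q) {e : ι → E}
    {A : ι → E × ℝ → ℝ} {g : E × ℝ → ℝ} (hA : ∀ i, ContDiff ℝ 1 (A i)) (hg : Continuous g)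
    {u v : E → ℝ} (hu : KzEnt μ Q e A g u) (hv : KzEnt μ Q e A g v)
    (hum : Measurable u) (hvm : Measurable v) {M : ℝ} (huM : ∀ p, |u p| ≤ M)
    (hvM : ∀ p, |v p| ≤ M) {ψ : E → ℝ} (hψ : ContDiff ℝ (⊤ : ℕ∞) ψ) (hψc : HasCompactSupport ψ)
    (hψ0 : ∀ p, 0 ≤ ψ p) (hψQ : tsupport ψ ⊆ Q) :
    0 ≤ ∫ p, Real.sign (u p - v p) * (∑ i, (A i (p, u p) - A i (p, v p)) * fderiv ℝ ψ p (e i)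
      + (g (p, u p) - g (p, v p)) * ψ p) ∂μ := by
  let b : ContDiffBump (0:E) := ⟨1/2, 1, by norm_num, by norm_num⟩
  set ρ : E → ℝ := fun z => b z with hρdef
  have hρ : ContDiff ℝ (⊤ : ℕ∞) ρ := b.contDiff
  have hρs : tsupport ρ ⊆ Metric.closedBall 0 1 := by
    rw [hρdef, b.tsupport_eq]
  have hρ0 : ∀ p, 0 ≤ ρ p := fun p => b.nonneg
  have hρc : HasCompactSupport ρ := b.hasCompactSupport
  have hρint : 0 < ∫ z, ρ z ∂μ := b.integral_pos
  choose Qf hQc hQ hQz using fun i => kz_quot (hA i)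
  have hKψ : IsCompact (tsupport ψ) := hψc
  have hKB : IsCompact (Metric.closedBall (0:E) 1) := isCompact_closedBall _ _
  have hdψ : Continuous (fderiv ℝ ψ) := hψ.continuous_fderiv (by simp)
  have hdρ : Continuous (fderiv ℝ ρ) := hρ.continuous_fderiv (by simp)
  have hdA : ∀ i, Continuous (fderiv ℝ (A i)) := fun i => (hA i).continuous_fderiv one_ne_zero
  have hAc : ∀ i, Continuous (A i) := fun i => (hA i).continuous
  have hψcont := hψ.continuous
  have hρcont := hρ.continuous
  set J : ℝ × (E × E) × ℝ × ℝ → ℝ := fun y =>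
      ∑ i, ((A i (y.2.1.1, y.2.2.1) - A i (y.2.1.1, y.2.2.2)) *
          (fderiv ℝ ψ y.2.1.1 (e i) * ρ y.2.1.2)
        + ψ y.2.1.1 * fderiv ℝ ρ y.2.1.2 (e i) *
          (Qf i (y.1, (y.2.1.1, y.2.1.2), y.2.2.1) - Qf i (y.1, (y.2.1.1, y.2.1.2), y.2.2.2)))
      + (-(∑ i, fderiv ℝ (A i) (y.2.1.1, y.2.2.2) (e i, 0))
        + (∑ i, fderiv ℝ (A i) (y.2.1.1 - y.1 • y.2.1.2, y.2.2.1) (e i, 0))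
        + g (y.2.1.1, y.2.2.1) - g (y.2.1.1 - y.1 • y.2.1.2, y.2.2.2)) *
          (ψ y.2.1.1 * ρ y.2.1.2) with hJdef
  have hJ : Continuous J := by
    rw [hJdef]
    have a1 : ∀ i, Continuous fun y : ℝ × (E × E) × ℝ × ℝ => fderiv ℝ ψ y.2.1.1 (e i) := fun i =>
      (hdψ.comp (by fun_prop)).clm_apply continuous_const
    have a2 : ∀ i, Continuous fun y : ℝ × (E × E) × ℝ × ℝ => fderiv ℝ ρ y.2.1.2 (e i) := fun i =>
      (hdρ.comp (by fun_prop)).clm_apply continuous_const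
    have a3 : ∀ i, Continuous fun y : ℝ × (E × E) × ℝ × ℝ =>
        fderiv ℝ (A i) (y.2.1.1, y.2.2.2) (e i, 0) := fun i =>
      ((hdA i).comp (by fun_prop)).clm_apply continuous_const
    have a4 : ∀ i, Continuous fun y : ℝ × (E × E) × ℝ × ℝ =>
        fderiv ℝ (A i) (y.2.1.1 - y.1 • y.2.1.2, y.2.2.1) (e i, 0) := fun i =>
      ((hdA i).comp (by fun_prop)).clm_apply continuous_const
    fun_prop
  have hJ0 : ∀ h, ∀ x ∉ tsupport ψ ×ˢ Metric.closedBall (0:E) 1, ∀ a b,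
      J (h, x, a, b) = 0 := by
    intro h x hx a b
    have : x.1 ∉ tsupport ψ ∨ x.2 ∉ tsupport ρ := by
      by_contra hc
      push Not at hc
      exact hx ⟨hc.1, hρs hc.2⟩
    rcases this with h1 | h1
    · simp [hJdef, kz_fderiv_zero h1, image_eq_zero_of_notMem_tsupport h1]
    · simp [hJdef, kz_fderiv_zero h1, image_eq_zero_of_notMem_tsupport h1]
  obtain ⟨δ, hδ, hδQ⟩ := hKψ.exists_cthickening_subset_open hQo hψQ
  obtain ⟨r0, hr0⟩ := hKψ.isBounded.subset_closedBall (0:E)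
  set r := max r0 1
  obtain ⟨h, hh, hh0, hconv⟩ := kz_ae_conv μ hvm hvM (r := r) (by positivity) hδ
  have hU : Measurable fun x : E × E => u x.1 := hum.comp measurable_fst
  have hVk : ∀ k, Measurable fun x : E × E => v (x.1 - h k • x.2) := fun k =>
    hvm.comp (measurable_fst.sub (measurable_snd.const_smul _))
  have hlim := kz_dct (μ.prod μ) (hKψ.prod hKB) J hJ hJ0 (by intro x a; simp [hJdef])
    (V := fun x => v x.1) hU hVk (fun x => huM x.1) (fun k x => hvM _)
    (fun k => ⟨(hh k).1.le, (hh k).2.1⟩) hh0 (by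
      filter_upwards [hconv] with x hx hxK
      exact hx ⟨Metric.closedBall_subset_closedBall (le_max_left _ _) (hr0 hxK.1),
        Metric.closedBall_subset_closedBall (le_max_right _ _) hxK.2⟩)
  have hnn : 0 ≤ ∫ x : E × E, Real.sign (u x.1 - v x.1) * J (0, x, u x.1, v x.1) ∂(μ.prod μ) := by
    refine ge_of_tendsto' hlim fun k => ?_
    refine kz_doubling μ hA hg hu hv hum hvm huM hvM hψ hψc hψ0 hψQ hρ hρs hρ0 hQc hQ
      (hh k).1 ?_ J hJ hJ0 (fun _ _ _ _ _ => rfl)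
    intro p hp q hq
    exact hδQ (Metric.mem_cthickening_of_dist_le q p δ _ hp (hq.trans (hh k).2.2.le))
  have i4 := kz_integrable (μ.prod μ) (hKψ.prod hKB) (fun y => J (0, y))
    (hJ.comp (by fun_prop)) (hJ0 0) hU (V := fun x : E × E => v x.1)
    (hvm.comp measurable_fst) (fun x => huM x.1) (fun x => hvM _)
  rw [integral_prod _ i4] at hnn
  have e1 : ∀ p, ∫ z, Real.sign (u p - v p) * J (0, (p, z), u p, v p) ∂μ
      = (∫ z, ρ z ∂μ) * (Real.sign (u p - v p) *
        (∑ i, (A i (p, u p) - A i (p, v p)) * fderiv ℝ ψ p (e i)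
      + (g (p, u p) - g (p, v p)) * ψ p)) := by
    intro p
    rw [integral_const_mul, mul_left_comm]
    congr 1
    have ρi : Integrable ρ μ := hρcont.integrable_of_hasCompactSupport hρc
    set L : ι → E →L[ℝ] ℝ := fun i =>
      (fderiv ℝ (A i) (p, u p) - fderiv ℝ (A i) (p, v p)).comp (ContinuousLinearMap.inl ℝ E ℝ)
      with hL
    have hJz : ∀ z, J (0, (p, z), u p, v p) =
        ∑ i, ((A i (p, u p) - A i (p, v p)) * fderiv ℝ ψ p (e i) * ρ z
          + ψ p * (fderiv ℝ ρ z (e i) * L i z))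
        + ((∑ i, L i (e i)) + (g (p, u p) - g (p, v p))) * ψ p * ρ z := by
      intro z
      simp only [hJdef, hQz, hL, zero_smul, sub_zero]
      have : ∑ i, ((fderiv ℝ (A i) (p, u p) - fderiv ℝ (A i) (p, v p)).comp
          (ContinuousLinearMap.inl ℝ E ℝ)) (e i)
          = ∑ i, fderiv ℝ (A i) (p, u p) (e i, 0) - ∑ i, fderiv ℝ (A i) (p, v p) (e i, 0) := by
        rw [← Finset.sum_sub_distrib]; simp
      rw [this]
      congr 1
      · refine Finset.sum_congr rfl fun i _ => ?_
        simp
        ring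
      · ring
    simp only [hJz]
    have j1 : ∀ i, Integrable (fun z => (A i (p, u p) - A i (p, v p)) * fderiv ℝ ψ p (e i) * ρ z) μ :=
      fun i => ρi.const_mul _
    have j2 : ∀ i, Integrable (fun z => ψ p * (fderiv ℝ ρ z (e i) * L i z)) μ :=
      fun i => (kz_ibp μ hρ hρc (L i) (e i)).1.const_mul _
    have j3 : ∀ i, Integrable (fun z => (A i (p, u p) - A i (p, v p)) * fderiv ℝ ψ p (e i) * ρ z
          + ψ p * (fderiv ℝ ρ z (e i) * L i z)) μ := fun i => (j1 i).add (j2 i)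
    rw [integral_add (integrable_finsetSum _ fun i _ => j3 i) (ρi.const_mul _),
      integral_finsetSum _ (fun i _ => j3 i)]
    have : ∀ i, ∫ z, ((A i (p, u p) - A i (p, v p)) * fderiv ℝ ψ p (e i) * ρ z
          + ψ p * (fderiv ℝ ρ z (e i) * L i z)) ∂μ
        = (∫ z, ρ z ∂μ) * ((A i (p, u p) - A i (p, v p)) * fderiv ℝ ψ p (e i))
          - (∫ z, ρ z ∂μ) * ψ p * L i (e i) := by
      intro i
      rw [integral_add (j1 i) (j2 i), integral_const_mul, integral_const_mul,
        (kz_ibp μ hρ hρc (L i) (e i)).2]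
      ring
    simp only [this]
    rw [Finset.sum_sub_distrib, ← Finset.mul_sum, ← Finset.mul_sum, integral_const_mul]
    ring
  simp only [e1] at hnn
  rw [integral_const_mul] at hnn
  exact nonneg_of_mul_nonneg_right hnn hρint

end Kato

section Concrete
open Topology
open scoped ContDiff

theorem kz_sign_mul_self (x : ℝ) : Real.sign x * x = |x| := by
  rcases lt_trichotomy x 0 with h | h | h
  · rw [Real.sign_of_neg h, abs_of_neg h]; ring
  · simp [h]
  · rw [Real.sign_of_pos h, abs_of_pos h]; ring

/-- coordinate directions in space-time. -/
def kzE (n : ℕ) : Option (Fin n) → ℝ × Euc n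
  | none => (1, 0)
  | some i => (0, EuclideanSpace.single i 1)

/-- space-time flux. -/
def kzA {n : ℕ} (f : Fin n → ℝ × Euc n × ℝ → ℝ) : Option (Fin n) → (ℝ × Euc n) × ℝ → ℝ
  | none => fun y => y.2
  | some i => fun y => f i (y.1.1, y.1.2, y.2)

theorem kzA_contDiff {n : ℕ} {f : Fin n → ℝ × Euc n × ℝ → ℝ} (hf : ∀ i, ContDiff ℝ 1 (f i))
    (i : Option (Fin n)) : ContDiff ℝ 1 (kzA f i) := by
  cases i with
  | none => exact contDiff_snd
  | some i =>
    refine (hf i).comp ?_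
    fun_prop

theorem kzA_fderiv {n : ℕ} {f : Fin n → ℝ × Euc n × ℝ → ℝ} (hf : ∀ i, ContDiff ℝ 1 (f i))
    (i : Fin n) (p : ℝ × Euc n) (k : ℝ) (e : ℝ × Euc n) :
    fderiv ℝ (kzA f (some i)) (p, k) (e, 0) = fderiv ℝ (f i) (p.1, p.2, k) (e.1, e.2, 0) := by
  have h1 : HasFDerivAt (fun y : (ℝ × Euc n) × ℝ => (y.1.1, y.1.2, y.2))
      (((ContinuousLinearMap.fst ℝ ℝ (Euc n)).comp (ContinuousLinearMap.fst ℝ (ℝ × Euc n) ℝ)).prod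
      (((ContinuousLinearMap.snd ℝ ℝ (Euc n)).comp
        (ContinuousLinearMap.fst ℝ (ℝ × Euc n) ℝ)).prod
      (ContinuousLinearMap.snd ℝ (ℝ × Euc n) ℝ))) (p, k) :=
    ContinuousLinearMap.hasFDerivAt (((ContinuousLinearMap.fst ℝ ℝ (Euc n)).comp
      (ContinuousLinearMap.fst ℝ (ℝ × Euc n) ℝ)).prod
      (((ContinuousLinearMap.snd ℝ ℝ (Euc n)).comp
        (ContinuousLinearMap.fst ℝ (ℝ × Euc n) ℝ)).prod
      (ContinuousLinearMap.snd ℝ (ℝ × Euc n) ℝ)))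
  have h2 := ((hf i).differentiable one_ne_zero (p.1, p.2, k)).hasFDerivAt.comp (p, k) h1
  have h3 : fderiv ℝ (kzA f (some i)) (p, k) = _ := h2.fderiv
  rw [h3]
  simp

theorem kz_ent_of_sol {n : ℕ} {T : ℝ} {f : Fin n → ℝ × Euc n × ℝ → ℝ} {g : ℝ × Euc n × ℝ → ℝ}
    (hf : ∀ i, ContDiff ℝ 1 (f i)) {u : ℝ × Euc n → ℝ} {u₀ : Euc n → ℝ}
    (hu : IsEntropySol n T f g u u₀) :
    KzEnt volume (Ioo (0:ℝ) T ×ˢ (univ : Set (Euc n))) (kzE n) (kzA f)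
      (fun y => g (y.1.1, y.1.2, y.2)) u := by
  intro k φ hφ hφc hφ0 hφs
  have h0 : ∀ p : ℝ × Euc n, p ∉ Ioo (0:ℝ) T ×ˢ (univ : Set (Euc n)) → p ∉ tsupport φ :=
    fun p hp hc => hp (hφs hc)
  have := hu.2.2.1 k φ hφ hφc hφ0 (fun p hp =>
    image_eq_zero_of_notMem_tsupport (h0 p fun hc => hp hc.1))
  rw [setIntegral_eq_integral_of_forall_compl_eq_zero] at this
  · refine this.trans_eq (integral_congr_ae (Eventually.of_forall fun p => ?_))
    simp only [Fintype.sum_option, kzA_fderiv hf]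
    have hn : fderiv ℝ (kzA f none) (p, k) (kzE n none, 0) = 0 := by
      have : kzA f none = fun y => y.2 := rfl
      rw [this, fderiv_snd]; simp
    rw [hn, zero_add]
    simp only [kzE, kzA]
    have hs : ∑ i, Real.sign (u p - k) * (f i (p.1, p.2, u p) - f i (p.1, p.2, k))
          * fderiv ℝ φ p (0, EuclideanSpace.single i 1)
        = Real.sign (u p - k) * ∑ i, (f i (p.1, p.2, u p) - f i (p.1, p.2, k))
          * fderiv ℝ φ p (0, EuclideanSpace.single i 1) := by
      rw [Finset.mul_sum]
      exact Finset.sum_congr rfl fun i _ => by ring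
    rw [hs, ← kz_sign_mul_self (u p - k)]
    ring
  · intro p hp
    simp [kz_fderiv_zero (h0 p hp), image_eq_zero_of_notMem_tsupport (h0 p hp)]

/-- flux bound. -/
theorem kz_flux_bound {n : ℕ} {f : Fin n → ℝ × Euc n × ℝ → ℝ} (hf : ∀ i, ContDiff ℝ 1 (f i))
    {t : ℝ} {x : Euc n} {M N R : ℝ} (hx : ‖x‖ ≤ R)
    (hN : ∀ w ∈ Icc (-M) M, Real.sqrt (∑ i, (fderiv ℝ (f i) (t, x, w) (0, 0, 1)) ^ 2) ≤ N)
    {a c : ℝ} (ha : a ∈ Icc (-M) M) (hc : c ∈ Icc (-M) M) :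
    |∑ i, (f i (t, x, a) - f i (t, x, c)) * x i| ≤ N * R * |a - c| := by
  have hd : ∀ s, HasDerivAt (fun s => ∑ i, f i (t, x, s) * x i)
      (∑ i, fderiv ℝ (f i) (t, x, s) (0, 0, 1) * x i) s := by
    intro s
    refine HasDerivAt.fun_sum fun i _ => HasDerivAt.mul_const ?_ _
    have h1 : HasDerivAt (fun s : ℝ => (t, x, s)) ((0, 0, 1) : ℝ × Euc n × ℝ) s :=
      (hasDerivAt_const _ _).prodMk ((hasDerivAt_const _ _).prodMk (hasDerivAt_id s))
    exact ((hf i).differentiable one_ne_zero (t, x, s)).hasFDerivAt.comp_hasDerivAt s h1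
  have := Convex.norm_image_sub_le_of_norm_hasDerivWithin_le (C := N * R)
    (fun s _ => (hd s).hasDerivWithinAt) (fun s hs => ?_) (convex_Icc (-M) M) hc ha
  · simpa only [Real.norm_eq_abs, ← Finset.sum_sub_distrib, ← sub_mul] using this
  · rw [Real.norm_eq_abs]
    have h2 : ‖x‖ = Real.sqrt (∑ i, (x i)^2) := by
      rw [EuclideanSpace.norm_eq]; simp
    have hcs : |∑ i, fderiv ℝ (f i) (t, x, s) (0, 0, 1) * x i| ≤
        Real.sqrt (∑ i, (fderiv ℝ (f i) (t, x, s) (0, 0, 1)) ^ 2) * Real.sqrt (∑ i, (x i)^2) := by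
      rw [← Real.sqrt_mul (Finset.sum_nonneg fun i _ => sq_nonneg _)]
      exact Real.abs_le_sqrt (Finset.sum_mul_sq_le_sq_mul_sq _ _ _)
    rw [← h2] at hcs
    refine hcs.trans (mul_le_mul (hN s hs) hx (norm_nonneg _) ((Real.sqrt_nonneg _).trans (hN s hs)))

/-- the weight. -/
def kzb (n : ℕ) (L T' N R : ℝ) (p : ℝ × Euc n) : ℝ :=
  Real.exp (-(L + 1) * p.1) * expNegInvGlue (T' - p.1) *
    expNegInvGlue (1 - (‖p.2‖ ^ 2 / R ^ 2 + 2 * N * p.1 / R))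

theorem kz_glue_contDiff : ContDiff ℝ (⊤ : ℕ∞) expNegInvGlue := expNegInvGlue.contDiff

theorem kz_glue_le_one (x : ℝ) : expNegInvGlue x ≤ 1 := by
  unfold expNegInvGlue
  split_ifs with h
  · exact zero_le_one
  · rw [Real.exp_le_one_iff]
    push Not at h
    simpa using h.le

theorem kzb_contDiff (n : ℕ) (L T' N R : ℝ) : ContDiff ℝ (⊤ : ℕ∞) (kzb n L T' N R) := by
  have h1 : ContDiff ℝ (⊤ : ℕ∞) (fun p : ℝ × Euc n => ‖p.2‖ ^ 2) := contDiff_snd.norm_sq ℝ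
  refine ContDiff.mul (ContDiff.mul ?_ (kz_glue_contDiff.comp ?_)) (kz_glue_contDiff.comp ?_)
  · fun_prop
  · fun_prop
  · fun_prop

theorem kzb_fderiv (n : ℕ) (L T' N R : ℝ) (p e : ℝ × Euc n) :
    fderiv ℝ (kzb n L T' N R) p e = -(L + 1) * e.1 * kzb n L T' N R p
      - e.1 * (Real.exp (-(L + 1) * p.1) * deriv expNegInvGlue (T' - p.1) *
        expNegInvGlue (1 - (‖p.2‖ ^ 2 / R ^ 2 + 2 * N * p.1 / R)))
      - Real.exp (-(L + 1) * p.1) * expNegInvGlue (T' - p.1) *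
        deriv expNegInvGlue (1 - (‖p.2‖ ^ 2 / R ^ 2 + 2 * N * p.1 / R)) *
          (2 * inner ℝ p.2 e.2 / R ^ 2 + 2 * N * e.1 / R) := by
  have hG : ∀ s, HasDerivAt expNegInvGlue (deriv expNegInvGlue s) s := fun s =>
    (kz_glue_contDiff.differentiable (by simp) s).hasDerivAt
  have hfst : HasFDerivAt (fun p : ℝ × Euc n => p.1) (ContinuousLinearMap.fst ℝ ℝ (Euc n)) p :=
    hasFDerivAt_fst
  have hsnd : HasFDerivAt (fun p : ℝ × Euc n => p.2) (ContinuousLinearMap.snd ℝ ℝ (Euc n)) p :=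
    hasFDerivAt_snd
  have h1 := (hfst.const_mul (-(L + 1))).exp
  have h2 := (hG (T' - p.1)).comp_hasFDerivAt p (hfst.const_sub T')
  have h3 := hsnd.norm_sq
  have h4 := (hG (1 - (‖p.2‖ ^ 2 / R ^ 2 + 2 * N * p.1 / R))).comp_hasFDerivAt p
    (((h3.mul_const (R ^ 2)⁻¹).add ((hfst.const_mul (2 * N)).mul_const R⁻¹)).const_sub 1)
  have h5 := (h1.mul h2).mul h4
  have h6 : fderiv ℝ (kzb n L T' N R) p = _ := h5.fderiv
  rw [h6]
  simp [kzb, div_eq_mul_inv]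
  ring

end Concrete

theorem kz_glue_deriv_nonneg (x : ℝ) : 0 ≤ deriv expNegInvGlue x := by
  have : Monotone expNegInvGlue := expNegInvGlue.monotone
  exact this.deriv_nonneg

theorem kz_cone {n : ℕ} {f : Fin n → ℝ × Euc n × ℝ → ℝ} (hf : ∀ i, ContDiff ℝ 1 (f i))
    {g : ℝ × Euc n × ℝ → ℝ} {p : ℝ × Euc n} {L T' M N R : ℝ} (hR : 0 < R)
    (hx : ‖p.2‖ ≤ R)
    (hN : ∀ w ∈ Icc (-M) M, Real.sqrt (∑ i, (fderiv ℝ (f i) (p.1, p.2, w) (0, 0, 1)) ^ 2) ≤ N)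
    {a c : ℝ} (ha : a ∈ Icc (-M) M) (hc : c ∈ Icc (-M) M)
    (hg : Real.sign (a - c) * (g (p.1, p.2, a) - g (p.1, p.2, c)) ≤ L * |a - c|) :
    Real.sign (a - c) * (((a - c) * fderiv ℝ (kzb n L T' N R) p (1, 0)
      + ∑ i, (f i (p.1, p.2, a) - f i (p.1, p.2, c)) *
          fderiv ℝ (kzb n L T' N R) p (0, EuclideanSpace.single i 1))
      + (g (p.1, p.2, a) - g (p.1, p.2, c)) * kzb n L T' N R p)
    ≤ - |a - c| * kzb n L T' N R p := by
  have hfl := kz_flux_bound hf hx hN ha hc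
  have hb : 0 ≤ kzb n L T' N R p := by
    unfold kzb
    have := expNegInvGlue.nonneg (T' - p.1)
    have := expNegInvGlue.nonneg (1 - (‖p.2‖ ^ 2 / R ^ 2 + 2 * N * p.1 / R))
    positivity
  have hP : 0 ≤ Real.exp (-(L + 1) * p.1) * expNegInvGlue (T' - p.1) *
        deriv expNegInvGlue (1 - (‖p.2‖ ^ 2 / R ^ 2 + 2 * N * p.1 / R)) := by
    have := expNegInvGlue.nonneg (T' - p.1)
    have := kz_glue_deriv_nonneg (1 - (‖p.2‖ ^ 2 / R ^ 2 + 2 * N * p.1 / R))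
    positivity
  have hP2 : 0 ≤ Real.exp (-(L + 1) * p.1) * deriv expNegInvGlue (T' - p.1) *
        expNegInvGlue (1 - (‖p.2‖ ^ 2 / R ^ 2 + 2 * N * p.1 / R)) := by
    have := expNegInvGlue.nonneg (1 - (‖p.2‖ ^ 2 / R ^ 2 + 2 * N * p.1 / R))
    have := kz_glue_deriv_nonneg (T' - p.1)
    positivity
  have hs := kz_sign_mul_self (a - c)
  have hs1 := kz_abs_sign_le (a - c)
  simp only [kzb_fderiv]
  generalize Real.exp (-(L + 1) * p.1) * expNegInvGlue (T' - p.1) *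
        deriv expNegInvGlue (1 - (‖p.2‖ ^ 2 / R ^ 2 + 2 * N * p.1 / R)) = P at *
  generalize Real.exp (-(L + 1) * p.1) * deriv expNegInvGlue (T' - p.1) *
        expNegInvGlue (1 - (‖p.2‖ ^ 2 / R ^ 2 + 2 * N * p.1 / R)) = P2 at *
  generalize kzb n L T' N R p = b at *
  have hsum : ∑ i, (f i (p.1, p.2, a) - f i (p.1, p.2, c)) *
      (-(L + 1) * 0 * b - 0 * P2 - P * (2 * inner ℝ p.2 (EuclideanSpace.single i (1:ℝ)) / R ^ 2
        + 2 * N * 0 / R)) = - (2 * P / R ^ 2) * ∑ i, (f i (p.1, p.2, a) - f i (p.1, p.2, c)) * p.2 i := by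
    rw [Finset.mul_sum]
    refine Finset.sum_congr rfl fun i _ => ?_
    have : inner ℝ p.2 (EuclideanSpace.single i (1:ℝ)) = p.2 i := by
      simp [EuclideanSpace.inner_single_right]
    rw [this]; ring
  rw [hsum]
  simp only [inner_zero_right]
  generalize ∑ i, (f i (p.1, p.2, a) - f i (p.1, p.2, c)) * p.2 i = S at *
  generalize Real.sign (a - c) = s at *
  have h1 : -(s * S) ≤ N * R * |a - c| := by
    calc -(s * S) ≤ |s * S| := neg_le_abs _
      _ = |s| * |S| := abs_mul _ _
      _ ≤ 1 * |S| := by gcongr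
      _ ≤ _ := by rw [one_mul]; exact hfl
  have h2 : (2 * P / R ^ 2) * (-(s * S)) ≤ (2 * P / R ^ 2) * (N * R * |a - c|) := by gcongr
  have h3 : (2 * P / R ^ 2) * (N * R * |a - c|) = P * (2 * N / R) * |a - c| := by
    field_simp
  have h4 : s * (g (p.1, p.2, a) - g (p.1, p.2, c)) * b ≤ L * |a - c| * b := by gcongr
  have h5 : 0 ≤ |a - c| * P2 := by positivity
  have : s * (((a - c) * (-(L + 1) * 1 * b - 1 * P2 - P * (2 * 0 / R ^ 2 + 2 * N * 1 / R))
      + -(2 * P / R ^ 2) * S) + (g (p.1, p.2, a) - g (p.1, p.2, c)) * b)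
      = (s * (a - c)) * (-(L + 1) * b - P2 - P * (2 * N / R)) + (2 * P / R ^ 2) * (-(s * S))
        + s * (g (p.1, p.2, a) - g (p.1, p.2, c)) * b := by ring
  rw [this, hs]
  nlinarith

theorem kzb_nonneg (n : ℕ) (L T' N R : ℝ) (p : ℝ × Euc n) : 0 ≤ kzb n L T' N R p := by
  unfold kzb
  have := expNegInvGlue.nonneg (T' - p.1)
  have := expNegInvGlue.nonneg (1 - (‖p.2‖ ^ 2 / R ^ 2 + 2 * N * p.1 / R))
  positivity

theorem kzb_le_one (n : ℕ) {L : ℝ} (T' N R : ℝ) (hL : 0 ≤ L) {p : ℝ × Euc n} (hp : 0 ≤ p.1) :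
    kzb n L T' N R p ≤ 1 := by
  unfold kzb
  have h1 := expNegInvGlue.nonneg (T' - p.1)
  have h2 := expNegInvGlue.nonneg (1 - (‖p.2‖ ^ 2 / R ^ 2 + 2 * N * p.1 / R))
  have h3 := kz_glue_le_one (T' - p.1)
  have h4 := kz_glue_le_one (1 - (‖p.2‖ ^ 2 / R ^ 2 + 2 * N * p.1 / R))
  have h5 : Real.exp (-(L + 1) * p.1) ≤ 1 := Real.exp_le_one_iff.2 (by nlinarith)
  exact mul_le_one₀ (mul_le_one₀ h5 h1 h3) h2 h4

theorem kzb_zero (n : ℕ) {L T' N R : ℝ} (hN : 0 ≤ N) (hR : 0 < R) {ε : ℝ} (hε : 0 ≤ ε)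
    {p : ℝ × Euc n} (hp : ε ≤ p.1) (hpK : p ∉ Icc ε T' ×ˢ Metric.closedBall (0 : Euc n) R) :
    kzb n L T' N R p = 0 := by
  unfold kzb
  by_cases hT : p.1 ≤ T'
  · have hx : R < ‖p.2‖ := by
      by_contra h
      exact hpK ⟨⟨hp, hT⟩, by simpa using not_lt.1 h⟩
    have h1 : 1 ≤ ‖p.2‖ ^ 2 / R ^ 2 := by
      rw [one_le_div (by positivity)]; gcongr
    have h2 : 0 ≤ 2 * N * p.1 / R := by
      have : 0 ≤ p.1 := hε.trans hp
      positivity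
    rw [expNegInvGlue.zero_of_nonpos (x := 1 - _) (by linarith), mul_zero]
  · rw [expNegInvGlue.zero_of_nonpos (x := T' - p.1) (by linarith)]; simp

theorem kzb_pos (n : ℕ) {L T' N R : ℝ} {p : ℝ × Euc n} (h1 : p.1 < T')
    (h2 : ‖p.2‖ ^ 2 / R ^ 2 + 2 * N * p.1 / R < 1) : 0 < kzb n L T' N R p := by
  unfold kzb
  have h1 := expNegInvGlue.pos_of_pos (x := T' - p.1) (by linarith)
  have h2 := expNegInvGlue.pos_of_pos
    (x := 1 - (‖p.2‖ ^ 2 / R ^ 2 + 2 * N * p.1 / R)) (by linarith)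
  positivity

theorem kz_st_contDiff : ContDiff ℝ (⊤ : ℕ∞) Real.smoothTransition :=
  Real.smoothTransition.contDiff

theorem kz_st_mono : Monotone Real.smoothTransition := Real.smoothTransition.monotone

theorem kz_st_deriv_nonneg (s : ℝ) : 0 ≤ deriv Real.smoothTransition s :=
  kz_st_mono.deriv_nonneg

theorem kz_st_deriv_left {s : ℝ} (hs : s < 0) : deriv Real.smoothTransition s = 0 := by
  have : Real.smoothTransition =ᶠ[nhds s] fun _ => 0 := by
    filter_upwards [Iio_mem_nhds hs] with x hx
    exact Real.smoothTransition.zero_of_nonpos hx.le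
  rw [this.deriv_eq]; simp

theorem kz_st_deriv_right {s : ℝ} (hs : 1 < s) : deriv Real.smoothTransition s = 0 := by
  have : Real.smoothTransition =ᶠ[nhds s] fun _ => 1 := by
    filter_upwards [Ioi_mem_nhds hs] with x hx
    exact Real.smoothTransition.one_of_one_le hx.le
  rw [this.deriv_eq]; simp

theorem kz_st_deriv_bdd : ∃ C : ℝ, 0 ≤ C ∧ ∀ s, deriv Real.smoothTransition s ≤ C := by
  have hc : Continuous (deriv Real.smoothTransition) :=
    kz_st_contDiff.continuous_deriv (by simp)
  obtain ⟨C, hC⟩ := (isCompact_Icc (a := (0:ℝ)) (b := 1)).exists_bound_of_continuousOn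
    hc.continuousOn
  have h0 : 0 ≤ C := (norm_nonneg _).trans (hC 0 (by simp))
  refine ⟨C, h0, fun s => ?_⟩
  rcases lt_or_ge s 0 with h | h
  · rw [kz_st_deriv_left h]; exact h0
  rcases lt_or_ge 1 s with h' | h'
  · rw [kz_st_deriv_right h']; exact h0
  exact (le_abs_self _).trans (hC s ⟨h, h'⟩)

def kzpsi (n : ℕ) (L T' N R ε : ℝ) (p : ℝ × Euc n) : ℝ :=
  Real.smoothTransition ((p.1 - ε) / ε) * kzb n L T' N R p

def kzc (n : ℕ) (L T' N R ε : ℝ) (p : ℝ × Euc n) : ℝ :=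
  deriv Real.smoothTransition ((p.1 - ε) / ε) / ε * kzb n L T' N R p

theorem kzpsi_contDiff (n : ℕ) (L T' N R ε : ℝ) : ContDiff ℝ (⊤ : ℕ∞) (kzpsi n L T' N R ε) := by
  unfold kzpsi
  exact (kz_st_contDiff.comp ((contDiff_fst.sub contDiff_const).div_const _)).mul
    (kzb_contDiff n L T' N R)

theorem kzc_continuous (n : ℕ) (L T' N R ε : ℝ) : Continuous (kzc n L T' N R ε) := by
  unfold kzc
  have hc : Continuous (deriv Real.smoothTransition) :=
    kz_st_contDiff.continuous_deriv (by simp)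
  have hb := (kzb_contDiff n L T' N R).continuous
  exact ((hc.comp ((continuous_fst.sub continuous_const).div_const _)).div_const _).mul hb

theorem kzpsi_fderiv (n : ℕ) (L T' N R ε : ℝ) (p e : ℝ × Euc n) :
    fderiv ℝ (kzpsi n L T' N R ε) p e =
      Real.smoothTransition ((p.1 - ε) / ε) * fderiv ℝ (kzb n L T' N R) p e
        + e.1 * kzc n L T' N R ε p := by
  have h1 : HasFDerivAt (kzb n L T' N R) (fderiv ℝ (kzb n L T' N R) p) p :=
    ((kzb_contDiff n L T' N R).differentiable (by simp) p).hasFDerivAt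
  have h2 : HasDerivAt Real.smoothTransition
      (deriv Real.smoothTransition ((p.1 - ε) / ε)) ((p.1 - ε) / ε) :=
    (kz_st_contDiff.differentiable (by simp) _).hasDerivAt
  have h3 : HasFDerivAt (fun p : ℝ × Euc n => (p.1 - ε) / ε)
      (ε⁻¹ • ContinuousLinearMap.fst ℝ ℝ (Euc n)) p := by
    simp only [div_eq_mul_inv]
    exact ((hasFDerivAt_fst (𝕜 := ℝ) (p := p)).sub_const ε).mul_const' ε⁻¹ |>.congr_fderiv
      (by ext <;> simp)
  have h4 := (h2.comp_hasFDerivAt p h3).mul h1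
  have h5 : fderiv ℝ (kzpsi n L T' N R ε) p = _ := h4.fderiv
  rw [h5]
  simp [kzc]
  ring

theorem kzpsi_zero (n : ℕ) {L T' N R : ℝ} (hN : 0 ≤ N) (hR : 0 < R) {ε : ℝ} (hε : 0 < ε)
    {p : ℝ × Euc n} (hpK : p ∉ Icc ε T' ×ˢ Metric.closedBall (0 : Euc n) R) :
    kzpsi n L T' N R ε p = 0 := by
  unfold kzpsi
  rcases le_total ε p.1 with h | h
  · rw [kzb_zero n hN hR hε.le h hpK, mul_zero]
  · rw [Real.smoothTransition.zero_of_nonpos, zero_mul]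
    exact div_nonpos_of_nonpos_of_nonneg (by linarith) hε.le

theorem kzc_zero (n : ℕ) {L T' N R : ℝ} (hN : 0 ≤ N) (hR : 0 < R) {ε : ℝ} (hε : 0 < ε)
    {p : ℝ × Euc n} (hpK : p ∉ Icc ε T' ×ˢ Metric.closedBall (0 : Euc n) R) :
    kzc n L T' N R ε p = 0 := by
  unfold kzc
  rcases le_or_gt ε p.1 with h | h
  · rw [kzb_zero n hN hR hε.le h hpK, mul_zero]
  · rw [kz_st_deriv_left, zero_div, zero_mul]
    exact div_neg_of_neg_of_pos (by linarith) hε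

theorem kzpsi_nonneg (n : ℕ) (L T' N R ε : ℝ) (p : ℝ × Euc n) : 0 ≤ kzpsi n L T' N R ε p :=
  mul_nonneg (Real.smoothTransition.nonneg _) (kzb_nonneg ..)

theorem kzc_nonneg (n : ℕ) (L T' N R : ℝ) {ε : ℝ} (hε : 0 < ε) (p : ℝ × Euc n) :
    0 ≤ kzc n L T' N R ε p :=
  mul_nonneg (div_nonneg (kz_st_deriv_nonneg _) hε.le) (kzb_nonneg ..)

theorem kzc_le (n : ℕ) {L T' N R : ℝ} (hL : 0 ≤ L) (hN : 0 ≤ N) (hR : 0 < R) {ε : ℝ} (hε : 0 < ε)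
    {C : ℝ} (hC0 : 0 ≤ C) (hC : ∀ s, deriv Real.smoothTransition s ≤ C) (p : ℝ × Euc n) :
    kzc n L T' N R ε p ≤
      (Icc ε (2 * ε) ×ˢ Metric.closedBall (0 : Euc n) R).indicator (fun _ => C / ε) p := by
  by_cases hp : p ∈ Icc ε (2 * ε) ×ˢ Metric.closedBall (0 : Euc n) R
  · rw [indicator_of_mem hp]
    unfold kzc
    have h1 : kzb n L T' N R p ≤ 1 := kzb_le_one n T' N R hL (hε.le.trans hp.1.1)
    have h2 := kzb_nonneg n L T' N R p
    have h3 := hC ((p.1 - ε) / ε)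
    calc _ ≤ C / ε * 1 := by gcongr
      _ = _ := mul_one _
  · rw [indicator_of_notMem hp]
    by_cases h2 : p.1 ≤ 2 * ε
    · refine (kzc_zero n hN hR hε fun h => hp ⟨⟨h.1.1, h2⟩, h.2⟩).le
    · unfold kzc
      rw [kz_st_deriv_right, zero_div, zero_mul]
      rw [lt_div_iff₀ hε]; linarith

theorem kzpsi_support (n : ℕ) {L T' N R : ℝ} (hN : 0 ≤ N) (hR : 0 < R) {ε : ℝ} (hε : 0 < ε) :
    tsupport (kzpsi n L T' N R ε) ⊆ Icc ε T' ×ˢ Metric.closedBall (0 : Euc n) R := by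
  refine closure_minimal (fun p hp => ?_) (isClosed_Icc.prod Metric.isClosed_closedBall)
  by_contra h
  exact hp (kzpsi_zero n hN hR hε h)

theorem kz_w_integrable {n : ℕ} {u v : ℝ × Euc n → ℝ} (hum : Measurable u) (hvm : Measurable v)
    {M : ℝ} (huM : ∀ p, |u p| ≤ M) (hvM : ∀ p, |v p| ≤ M) {h : ℝ × Euc n → ℝ} (hh : Continuous h)
    {K : Set (ℝ × Euc n)} (hK : IsCompact K) (hK0 : ∀ p ∉ K, h p = 0) :
    Integrable (fun p => |u p - v p| * h p) := by
  have := kz_integrable (volume : Measure (ℝ × Euc n)) hK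
    (fun y => (y.2.1 - y.2.2) * h y.1) (by fun_prop)
    (fun x hx a b => by simp [hK0 x hx]) hum hvm huM hvM
  refine this.congr (Eventually.of_forall fun p => ?_)
  simp only
  rw [← mul_assoc, kz_sign_mul_self]

theorem kz_slab_eps {n : ℕ} {T : ℝ} {f : Fin n → ℝ × Euc n × ℝ → ℝ} (hf : ∀ i, ContDiff ℝ 1 (f i))
    {g : ℝ × Euc n × ℝ → ℝ} (hg : Continuous g) {L T' M N R : ℝ} (hR : 0 < R)
    (hN0 : 0 ≤ N) (hTT : T' < T)
    (hN : ∀ p ∈ Icc 0 T ×ˢ Metric.closedBall (0 : Euc n) R, ∀ w ∈ Icc (-M) M,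
      Real.sqrt (∑ i, (fderiv ℝ (f i) (p.1, p.2, w) (0, 0, 1)) ^ 2) ≤ N)
    (hgL : ∀ p ∈ Icc 0 T ×ˢ Metric.closedBall (0 : Euc n) R, ∀ a ∈ Icc (-M) M, ∀ c ∈ Icc (-M) M,
      Real.sign (a - c) * (g (p.1, p.2, a) - g (p.1, p.2, c)) ≤ L * |a - c|)
    {u v : ℝ × Euc n → ℝ} {u₀ : Euc n → ℝ}
    (hu : IsEntropySol n T f g u u₀) (hv : IsEntropySol n T f g v u₀)
    (huM : ∀ p, |u p| ≤ M) (hvM : ∀ p, |v p| ≤ M) {ε : ℝ} (hε : 0 < ε) :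
    ∫ p, |u p - v p| * kzpsi n L T' N R ε p ≤ ∫ p, |u p - v p| * kzc n L T' N R ε p := by
  haveI : (volume : Measure (ℝ × Euc n)).IsAddHaarMeasure :=
    inferInstanceAs ((volume : Measure ℝ).prod (volume : Measure (Euc n))).IsAddHaarMeasure
  have hKc : IsCompact (Icc ε T' ×ˢ Metric.closedBall (0 : Euc n) R) :=
    isCompact_Icc.prod (isCompact_closedBall _ _)
  have hsup := kzpsi_support n (L := L) (T' := T') hN0 hR hε
  have hi1 := kz_w_integrable hu.1 hv.1 huM hvM (kzpsi_contDiff n L T' N R ε).continuous hKc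
    (fun p hp => kzpsi_zero n hN0 hR hε hp)
  have hi2 := kz_w_integrable hu.1 hv.1 huM hvM (kzc_continuous n L T' N R ε) hKc
    (fun p hp => kzc_zero n hN0 hR hε hp)
  have hk := kz_kato (volume : Measure (ℝ × Euc n)) (isOpen_Ioo.prod isOpen_univ)
    (kzA_contDiff hf) (by fun_prop) (kz_ent_of_sol hf hu) (kz_ent_of_sol hf hv) hu.1 hv.1 huM hvM
    (kzpsi_contDiff n L T' N R ε) (HasCompactSupport.of_support_subset_isCompact hKc
      ((subset_tsupport _).trans hsup)) (kzpsi_nonneg n L T' N R ε)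
    (hsup.trans fun p hp => ⟨⟨hε.trans_le hp.1.1, hp.1.2.trans_lt hTT⟩, trivial⟩)
  have hle : ∫ p, Real.sign (u p - v p) * (∑ i, (kzA f i (p, u p) - kzA f i (p, v p)) *
      fderiv ℝ (kzpsi n L T' N R ε) p (kzE n i)
      + (g (p.1, p.2, u p) - g (p.1, p.2, v p)) * kzpsi n L T' N R ε p)
      ≤ ∫ p, (|u p - v p| * kzc n L T' N R ε p - |u p - v p| * kzpsi n L T' N R ε p) := by
    have hIntg : Integrable (fun p => Real.sign (u p - v p) *
      (∑ i, (kzA f i (p, u p) - kzA f i (p, v p)) *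
      fderiv ℝ (kzpsi n L T' N R ε) p (kzE n i)
      + (g (p.1, p.2, u p) - g (p.1, p.2, v p)) * kzpsi n L T' N R ε p)) := by
      have hdψ : Continuous (fderiv ℝ (kzpsi n L T' N R ε)) :=
        (kzpsi_contDiff n L T' N R ε).continuous_fderiv (by simp)
      have hψ := (kzpsi_contDiff n L T' N R ε).continuous
      have hAc : ∀ i, Continuous (kzA f i) := fun i => (kzA_contDiff hf i).continuous
      have a1 : ∀ i, Continuous fun y : (ℝ × Euc n) × ℝ × ℝ =>
          fderiv ℝ (kzpsi n L T' N R ε) y.1 (kzE n i) := fun i =>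
        (hdψ.comp continuous_fst).clm_apply continuous_const
      refine kz_integrable (volume : Measure (ℝ × Euc n)) hKc
        (fun y => ∑ i, (kzA f i (y.1, y.2.1) - kzA f i (y.1, y.2.2)) *
          fderiv ℝ (kzpsi n L T' N R ε) y.1 (kzE n i)
          + (g (y.1.1, y.1.2, y.2.1) - g (y.1.1, y.1.2, y.2.2)) * kzpsi n L T' N R ε y.1)
        (by fun_prop) (fun p hp a b => ?_) hu.1 hv.1 huM hvM
      have h1 : fderiv ℝ (kzpsi n L T' N R ε) p = 0 := kz_fderiv_zero fun h => hp (hsup h)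
      have h2 := kzpsi_zero n (L := L) (T' := T') hN0 hR hε hp
      simp [h1, h2]
    refine integral_mono hIntg (hi2.sub hi1) fun p => ?_
    by_cases hp : p ∈ Icc ε T' ×ˢ Metric.closedBall (0 : Euc n) R
    · have hp' : p ∈ Icc 0 T ×ˢ Metric.closedBall (0 : Euc n) R :=
        ⟨⟨hε.le.trans hp.1.1, hp.1.2.trans hTT.le⟩, hp.2⟩
      have hc := kz_cone (T' := T') hf hR (by simpa using hp.2) (hN p hp') (abs_le.1 (huM p))
        (abs_le.1 (hvM p)) (hgL p hp' _ (abs_le.1 (huM p)) _ (abs_le.1 (hvM p)))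
      have hS := mul_le_mul_of_nonneg_left hc
        (Real.smoothTransition.nonneg ((p.1 - ε) / ε))
      have hs := kz_sign_mul_self (u p - v p)
      simp only [Fintype.sum_option, kzpsi_fderiv]
      simp only [kzE, kzA, kzpsi, one_mul, zero_mul, add_zero]
      have hsum : ∑ i, (f i (p.1, p.2, u p) - f i (p.1, p.2, v p)) *
          (Real.smoothTransition ((p.1 - ε) / ε) *
            fderiv ℝ (kzb n L T' N R) p (0, EuclideanSpace.single i 1)) =
          Real.smoothTransition ((p.1 - ε) / ε) *
          ∑ i, (f i (p.1, p.2, u p) - f i (p.1, p.2, v p)) *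
            fderiv ℝ (kzb n L T' N R) p (0, EuclideanSpace.single i 1) := by
        rw [Finset.mul_sum]
        exact Finset.sum_congr rfl fun i _ => by ring
      rw [hsum]
      have hs' : Real.sign (u p - v p) * ((u p - v p) * kzc n L T' N R ε p)
        = |u p - v p| * kzc n L T' N R ε p := by rw [← mul_assoc, hs]
      linarith
    · have h1 : fderiv ℝ (kzpsi n L T' N R ε) p = 0 := kz_fderiv_zero fun h => hp (hsup h)
      have h2 := kzpsi_zero n (L := L) (T' := T') hN0 hR hε hp
      simp only [h1, h2]
      have := kzc_nonneg n L T' N R hε p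
      simp
      positivity
  have := hk.trans hle
  rw [integral_sub hi2 hi1] at this
  linarith

theorem kz_init {n : ℕ} {T : ℝ} (hT : 0 < T) {f : Fin n → ℝ × Euc n × ℝ → ℝ}
    {g : ℝ × Euc n × ℝ → ℝ} {M R : ℝ} (hR : 0 < R)
    {u v : ℝ × Euc n → ℝ} {u₀ : Euc n → ℝ} (hu₀m : Measurable u₀) (hu₀b : ∃ C : ℝ, ∀ x, |u₀ x| ≤ C)
    (hu : IsEntropySol n T f g u u₀) (hv : IsEntropySol n T f g v u₀)
    (huM : ∀ p, |u p| ≤ M) (hvM : ∀ p, |v p| ≤ M) {τ : ℝ} (hτ : 0 < τ) :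
    ∃ δ > 0, ∀ᵐ t : ℝ, t ∈ Ioo 0 δ →
      ∫ x in Metric.closedBall (0 : Euc n) R, |u (t, x) - v (t, x)| ≤ τ := by
  obtain ⟨C, hC⟩ := hu₀b
  obtain ⟨hum, -, -, Z1, hZ1, hl1⟩ := hu
  obtain ⟨hvm, -, -, Z2, hZ2, hl2⟩ := hv
  have e1 := (hl1 R hR).eventually (gt_mem_nhds (half_pos hτ))
  have e2 := (hl2 R hR).eventually (gt_mem_nhds (half_pos hτ))
  rw [eventually_nhdsWithin_iff, Metric.eventually_nhds_iff] at e1 e2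
  obtain ⟨d1, hd1, e1⟩ := e1
  obtain ⟨d2, hd2, e2⟩ := e2
  refine ⟨min T (min d1 d2), by positivity, ?_⟩
  have n1 : ∀ᵐ t : ℝ, t ∉ Z1 := measure_eq_zero_iff_ae_notMem.1 hZ1
  have n2 : ∀ᵐ t : ℝ, t ∉ Z2 := measure_eq_zero_iff_ae_notMem.1 hZ2
  filter_upwards [n1, n2] with t h1 h2 ht
  obtain ⟨ht0, ht⟩ := ht
  rw [lt_min_iff, lt_min_iff] at ht
  have hd : dist t 0 = t := by simp [abs_of_pos ht0]
  have a1 := e1 (hd.trans_lt ht.2.1) ⟨⟨ht0.le, ht.1.le⟩, h1⟩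
  have a2 := e2 (hd.trans_lt ht.2.2) ⟨⟨ht0.le, ht.1.le⟩, h2⟩
  haveI : IsFiniteMeasure ((volume : Measure (Euc n)).restrict (Metric.closedBall 0 R)) :=
    ⟨by simpa using measure_closedBall_lt_top⟩
  have key : ∀ w : ℝ × Euc n → ℝ, Measurable w → (∀ p, |w p| ≤ M) →
      IntegrableOn (fun x => |w (t, x) - u₀ x|) (Metric.closedBall (0 : Euc n) R) := by
    intro w hw hwM
    refine Integrable.of_bound (C := M + C) ?_ (Eventually.of_forall fun x => ?_)
    · have : Measurable fun x => w (t, x) := hw.comp measurable_prodMk_left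
      exact (this.sub hu₀m).abs.aestronglyMeasurable
    · rw [Real.norm_eq_abs, abs_abs]
      exact (abs_sub _ _).trans (add_le_add (hwM _) (hC _))
  have k1 := key u hum huM
  have k2 := key v hvm hvM
  calc _ ≤ ∫ x in Metric.closedBall (0 : Euc n) R, (|u (t, x) - u₀ x| + |v (t, x) - u₀ x|) := by
        refine integral_mono_of_nonneg (Eventually.of_forall fun x => abs_nonneg _) (k1.add k2)
          (Eventually.of_forall fun x => ?_)
        have := abs_sub_le (u (t, x)) (u₀ x) (v (t, x))
        rw [abs_sub_comm (u₀ x)] at this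
        exact this
    _ = _ := integral_add k1 k2
    _ ≤ τ := by linarith

theorem kz_slab {n : ℕ} {T : ℝ} (hT : 0 < T) {f : Fin n → ℝ × Euc n × ℝ → ℝ}
    (hf : ∀ i, ContDiff ℝ 1 (f i))
    {g : ℝ × Euc n × ℝ → ℝ} (hg : Continuous g) {L T' M N R : ℝ} (hL : 0 ≤ L) (hR : 0 < R)
    (hN0 : 0 ≤ N) (hTT : T' < T)
    (hN : ∀ p ∈ Icc 0 T ×ˢ Metric.closedBall (0 : Euc n) R, ∀ w ∈ Icc (-M) M,
      Real.sqrt (∑ i, (fderiv ℝ (f i) (p.1, p.2, w) (0, 0, 1)) ^ 2) ≤ N)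
    (hgL : ∀ p ∈ Icc 0 T ×ˢ Metric.closedBall (0 : Euc n) R, ∀ a ∈ Icc (-M) M, ∀ c ∈ Icc (-M) M,
      Real.sign (a - c) * (g (p.1, p.2, a) - g (p.1, p.2, c)) ≤ L * |a - c|)
    {u v : ℝ × Euc n → ℝ} {u₀ : Euc n → ℝ} (hu₀m : Measurable u₀) (hu₀b : ∃ C : ℝ, ∀ x, |u₀ x| ≤ C)
    (hu : IsEntropySol n T f g u u₀) (hv : IsEntropySol n T f g v u₀)
    (huM : ∀ p, |u p| ≤ M) (hvM : ∀ p, |v p| ≤ M) {t0 : ℝ} (ht0 : 0 < t0) :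
    ∀ᵐ p : ℝ × Euc n, t0 ≤ p.1 → p.1 < T' →
      ‖p.2‖ ^ 2 / R ^ 2 + 2 * N * p.1 / R < 1 → u p = v p := by
  obtain ⟨C, hC0, hC⟩ := kz_st_deriv_bdd
  set A : Set (ℝ × Euc n) := {p | t0 ≤ p.1} with hA
  have hAm : MeasurableSet A := measurableSet_le measurable_const measurable_fst
  have hi : ∀ ε : ℝ, 0 < ε → Integrable (fun p => |u p - v p| * kzpsi n L T' N R ε p) :=
    fun ε hε => kz_w_integrable hu.1 hv.1 huM hvM (kzpsi_contDiff n L T' N R ε).continuous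
      (isCompact_Icc.prod (isCompact_closedBall _ _))
      (fun p hp => kzpsi_zero n hN0 hR hε hp)
  have hpsi : ∀ ε : ℝ, 0 < ε → 2 * ε ≤ t0 → ∀ p ∈ A, |u p - v p| * kzpsi n L T' N R ε p
      = |u p - v p| * kzb n L T' N R p := by
    intro ε hε h2 p hp
    have hp' : t0 ≤ p.1 := hp
    unfold kzpsi
    rw [Real.smoothTransition.one_of_one_le, one_mul]
    rw [one_le_div hε]; linarith
  have hIntg : IntegrableOn (fun p => |u p - v p| * kzb n L T' N R p) A := by
    refine (hi (t0 / 2) (by positivity)).integrableOn.congr_fun ?_ hAm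
    intro p hp
    exact hpsi _ (by positivity) (by linarith) p hp
  have hbound : ∀ τ : ℝ, 0 < τ → ∫ p in A, |u p - v p| * kzb n L T' N R p ≤ C * τ := by
    intro τ hτ
    obtain ⟨δ, hδ, hm⟩ := kz_init (f := f) (g := g) hT hR hu₀m hu₀b hu hv huM hvM hτ
    obtain ⟨ε, hε, hε1, hε2⟩ : ∃ ε : ℝ, 0 < ε ∧ 2 * ε ≤ t0 ∧ 2 * ε < δ :=
      ⟨min t0 δ / 4, by positivity, by linarith [min_le_left t0 δ, lt_min ht0 hδ],
        by linarith [min_le_right t0 δ, lt_min ht0 hδ]⟩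
    have s1 : ∫ p in A, |u p - v p| * kzb n L T' N R p
        ≤ ∫ p, |u p - v p| * kzpsi n L T' N R ε p := by
      rw [← setIntegral_congr_fun hAm (fun p hp => hpsi ε hε hε1 p hp)]
      exact setIntegral_le_integral (hi ε hε)
        (Eventually.of_forall fun p => mul_nonneg (abs_nonneg _) (kzpsi_nonneg ..))
    have s2 := kz_slab_eps hf hg hR hN0 hTT hN hgL hu hv huM hvM hε
    set D := Icc ε (2 * ε) ×ˢ Metric.closedBall (0 : Euc n) R with hD
    have hDc : IsCompact D := isCompact_Icc.prod (isCompact_closedBall _ _)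
    have hDm : MeasurableSet D := hDc.measurableSet
    have hwD : IntegrableOn (fun p => |u p - v p|) D := by
      haveI : IsFiniteMeasure ((volume : Measure (ℝ × Euc n)).restrict D) :=
        ⟨by simpa using hDc.measure_lt_top⟩
      refine Integrable.of_bound (C := M + M) (hu.1.sub hv.1).abs.aestronglyMeasurable
        (Eventually.of_forall fun x => ?_)
      rw [Real.norm_eq_abs, abs_abs]
      exact (abs_sub _ _).trans (add_le_add (huM _) (hvM _))
    have s3 : ∫ p, |u p - v p| * kzc n L T' N R ε p ≤ ∫ p in D, |u p - v p| * (C / ε) := by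
      rw [← integral_indicator hDm]
      refine integral_mono_of_nonneg (Eventually.of_forall fun p =>
        mul_nonneg (abs_nonneg _) (kzc_nonneg n L T' N R hε p))
        ((integrable_indicator_iff hDm).2 (hwD.mul_const _)) (Eventually.of_forall fun p => ?_)
      have := mul_le_mul_of_nonneg_left
        (kzc_le n (L := L) (T' := T') (N := N) hL hN0 hR hε hC0 hC p) (abs_nonneg (u p - v p))
      by_cases hp : p ∈ D
      · rw [indicator_of_mem hp] at this ⊢; exact this
      · rw [indicator_of_notMem hp] at this ⊢; simpa using this
    have s4 : ∫ p in D, |u p - v p| ≤ τ * ε := by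
      have : ∫ p in D, |u p - v p| = ∫ t in Icc ε (2 * ε),
          ∫ x in Metric.closedBall (0 : Euc n) R, |u (t, x) - v (t, x)| := by
        rw [Measure.volume_eq_prod] at hwD ⊢
        exact setIntegral_prod _ hwD
      rw [this]
      have hb := norm_setIntegral_le_of_norm_le_const_ae (μ := (volume : Measure ℝ))
        (s := Icc ε (2 * ε)) (C := τ)
        (f := fun t => ∫ x in Metric.closedBall (0 : Euc n) R, |u (t, x) - v (t, x)|)
        (by simp) (by
          filter_upwards [ae_restrict_of_ae hm, ae_restrict_mem measurableSet_Icc] with t ht ht'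
          rw [Real.norm_of_nonneg (integral_nonneg fun x => abs_nonneg _)]
          exact ht ⟨hε.trans_le ht'.1, ht'.2.trans_lt hε2⟩)
      refine (Real.le_norm_self _).trans (hb.trans (le_of_eq ?_))
      rw [Real.volume_real_Icc_of_le (by linarith)]
      ring
    rw [integral_mul_const] at s3
    have s5 : (∫ p in D, |u p - v p|) * (C / ε) ≤ τ * ε * (C / ε) := by gcongr
    have s6 : τ * ε * (C / ε) = C * τ := by field_simp
    linarith
  have hzero : ∫ p in A, |u p - v p| * kzb n L T' N R p = 0 := by
    refine le_antisymm ?_ (integral_nonneg fun p => mul_nonneg (abs_nonneg _) (kzb_nonneg ..))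
    refine le_of_forall_pos_le_add fun η hη => ?_
    have := hbound (η / (C + 1)) (by positivity)
    have h2 : C * (η / (C + 1)) ≤ η := by
      rw [← mul_div_assoc, div_le_iff₀ (by positivity)]; nlinarith
    linarith
  rw [setIntegral_eq_zero_iff_of_nonneg_ae
    (Eventually.of_forall fun p => mul_nonneg (abs_nonneg _) (kzb_nonneg ..)) hIntg] at hzero
  have hz2 := (ae_restrict_iff' hAm).1 hzero
  filter_upwards [hz2] with p hp h1 h2 h3
  have h4 := hp h1
  have h5 := kzb_pos n (L := L) h2 h3
  rcases mul_eq_zero.1 h4 with h | h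
  · exact sub_eq_zero.1 (abs_eq_zero.1 h)
  · exact absurd h h5.ne'


/-- Uniqueness, Theorem 3.2 of the paper.  Under the assumptions of the
stability theorem on the fluxes `f_i` and the source `g`, if in addition
`N_M(R) := max_{[0,T]×B_R(0)×[-M,M]} (∑ (∂f_i/∂u)²)^{1/2}` satisfies `N_M(R)/R → 0` as
`R → ∞` for every `M > 0`, then any two Kruzkov entropy solutions with the same bounded
initial data `u₀ ∈ L^∞` coincide almost everywhere in `[0,T] × ℝⁿ`. -/
theorem uniqueness_of_entropy_solutions
    (n : ℕ) (hn : 1 ≤ n) (T : ℝ) (hT : 0 < T)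
    (f : Fin n → ℝ × Euc n × ℝ → ℝ) (g : ℝ × Euc n × ℝ → ℝ)
    (hf : ∀ i, ContDiff ℝ 1 (f i))
    (hfxu : ∀ i j, Continuous fun p : ℝ × Euc n × ℝ =>
      fderiv ℝ (fun q => fderiv ℝ (f i) q (0, 0, 1)) p (0, EuclideanSpace.single j 1, 0))
    (hftu : ∀ i, Continuous fun p : ℝ × Euc n × ℝ =>
      fderiv ℝ (fun q => fderiv ℝ (f i) q (0, 0, 1)) p (1, 0, 0))
    (hg : Continuous g)
    (hgRL : ∀ Ω : Set (ℝ × Euc n), IsCompact Ω → ∀ a b : ℝ, a < b →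
      ∃ L : ℝ, ∀ p ∈ Ω, ∀ w ∈ Set.Icc a b, ∀ z ∈ Set.Icc a b, w ≠ z →
        (g (p.1, p.2, w) - g (p.1, p.2, z)) / (w - z) ≤ L)
    (NM : ℝ → ℝ → ℝ)
    (hNM : ∀ M R : ℝ, 0 < M → 0 < R →
      IsGreatest {y : ℝ | ∃ t ∈ Set.Icc (0:ℝ) T, ∃ x ∈ Metric.closedBall (0 : Euc n) R,
        ∃ w ∈ Set.Icc (-M) M,
          y = Real.sqrt (∑ i, (fderiv ℝ (f i) (t, x, w) (0, 0, 1)) ^ 2)} (NM M R))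
    (hNMgrowth : ∀ M : ℝ, 0 < M →
      Tendsto (fun R => NM M R / R) atTop (nhds 0))
    (u₀ : Euc n → ℝ) (hu₀m : Measurable u₀) (hu₀b : ∃ C : ℝ, ∀ x, |u₀ x| ≤ C)
    (u v : ℝ × Euc n → ℝ)
    (hu : IsEntropySol n T f g u u₀) (hv : IsEntropySol n T f g v u₀) :
    ∀ᵐ p ∂(volume.restrict ((Set.Icc (0:ℝ) T) ×ˢ (Set.univ : Set (Euc n)))),
      u p = v p := by
  obtain ⟨M1, hM1⟩ := hu.2.1
  obtain ⟨M2, hM2⟩ := hv.2.1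
  set M := max (max M1 M2) 1 with hMdef
  have hM : 0 < M := lt_of_lt_of_le one_pos (le_max_right _ _)
  have huM : ∀ p, |u p| ≤ M := fun p => (hM1 p).trans ((le_max_left _ _).trans (le_max_left _ _))
  have hvM : ∀ p, |v p| ≤ M := fun p => (hM2 p).trans ((le_max_right _ _).trans (le_max_left _ _))
  have main : ∀ m : ℕ, ∀ᵐ p : ℝ × Euc n, 1 / ((m:ℝ) + 1) ≤ p.1 → p.1 < T - 1 / ((m:ℝ) + 1) →
      ‖p.2‖ ≤ m → u p = v p := by
    intro m
    have hlim : Tendsto (fun R : ℝ => (m:ℝ) ^ 2 / R ^ 2 + 2 * T * (NM M R / R)) atTop (nhds 0) := by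
      have h1 : Tendsto (fun R : ℝ => (m:ℝ) ^ 2 / R ^ 2) atTop (nhds 0) :=
        tendsto_const_nhds.div_atTop (tendsto_pow_atTop two_ne_zero)
      simpa using h1.add ((hNMgrowth M hM).const_mul (2 * T))
    obtain ⟨R, hRlt, hR⟩ := ((hlim.eventually (gt_mem_nhds one_pos)).and
      (eventually_gt_atTop (0:ℝ))).exists
    obtain ⟨hmem, hub⟩ := hNM M R hM hR
    have hN0 : 0 ≤ NM M R := by
      obtain ⟨t, -, x, -, w, -, h⟩ := hmem
      rw [h]; exact Real.sqrt_nonneg _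
    obtain ⟨L, hL⟩ := hgRL (Icc 0 T ×ˢ Metric.closedBall (0 : Euc n) R)
      (isCompact_Icc.prod (isCompact_closedBall _ _)) (-M) M (by linarith)
    have hgL : ∀ p ∈ Icc 0 T ×ˢ Metric.closedBall (0 : Euc n) R, ∀ a ∈ Icc (-M) M,
        ∀ c ∈ Icc (-M) M,
        Real.sign (a - c) * (g (p.1, p.2, a) - g (p.1, p.2, c)) ≤ max L 0 * |a - c| := by
      intro p hp a ha c hc
      rcases eq_or_ne a c with rfl | hac
      · simp
      have h1 := hL p hp a ha c hc hac
      have h2 : a - c ≠ 0 := sub_ne_zero.2 hac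
      have h3 : Real.sign (a - c) * (g (p.1, p.2, a) - g (p.1, p.2, c))
          = (g (p.1, p.2, a) - g (p.1, p.2, c)) / (a - c) * |a - c| := by
        rw [← kz_sign_mul_self (a - c)]; field_simp
      rw [h3]
      exact mul_le_mul_of_nonneg_right (h1.trans (le_max_left _ _)) (abs_nonneg _)
    have hpos : 0 < 1 / ((m:ℝ) + 1) := by positivity
    have := kz_slab (T' := T - 1 / ((m:ℝ) + 1)) (N := NM M R) hT hf hg (le_max_right L 0) hR hN0
      (by linarith)
      (fun p hp w hw => hub ⟨p.1, hp.1, p.2, hp.2, w, hw, rfl⟩) hgL hu₀m hu₀b hu hv huM hvM hpos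
    filter_upwards [this] with p hp h1 h2 h3
    refine hp h1 h2 (lt_of_le_of_lt ?_ hRlt)
    have hpT : p.1 ≤ T := by linarith
    have e1 : ‖p.2‖ ^ 2 / R ^ 2 ≤ (m:ℝ) ^ 2 / R ^ 2 := by gcongr
    have e2 : 2 * NM M R * p.1 / R ≤ 2 * T * (NM M R / R) := by
      calc 2 * NM M R * p.1 / R ≤ 2 * NM M R * T / R := by gcongr
        _ = _ := by ring
    exact add_le_add e1 e2
  have hnull : ∀ c : ℝ, ∀ᵐ p : ℝ × Euc n, p.1 ≠ c := by
    intro c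
    have : (volume : Measure (ℝ × Euc n)) ({c} ×ˢ univ) = 0 := by
      rw [Measure.volume_eq_prod, Measure.prod_prod]; simp
    filter_upwards [measure_eq_zero_iff_ae_notMem.1 this] with p hp h
    exact hp ⟨h, trivial⟩
  rw [ae_restrict_iff' (measurableSet_Icc.prod MeasurableSet.univ)]
  filter_upwards [ae_all_iff.2 main, hnull 0, hnull T] with p hp h0 h1 hpI
  have hp0 : 0 < p.1 := lt_of_le_of_ne hpI.1.1 (Ne.symm h0)
  have hp1 : 0 < T - p.1 := sub_pos.2 (lt_of_le_of_ne hpI.1.2 h1)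
  obtain ⟨m1, hm1⟩ := exists_nat_one_div_lt (lt_min hp0 hp1)
  obtain ⟨m2, hm2⟩ := exists_nat_ge ‖p.2‖
  have hle : 1 / (((max m1 m2 : ℕ) : ℝ) + 1) ≤ 1 / ((m1 : ℝ) + 1) := by
    have : (m1:ℝ) ≤ ((max m1 m2 : ℕ) : ℝ) := by exact_mod_cast le_max_left _ _
    gcongr
  have hlt := hle.trans_lt hm1
  rw [lt_min_iff] at hlt
  refine hp (max m1 m2) hlt.1.le (by linarith [hlt.2]) (hm2.trans ?_)
  exact_mod_cast le_max_right _ _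
end
end

section
/- Let g : ℝ → ℝ be continuous, one-sided Lipschitz on every compact interval, and satisfy limsup_{η→+∞} g(η)/η < ∞ and limsup_{η→−∞} g(η)/η < ∞. Then for every s ∈ ℝ there exists a unique function ū(·,s) : [0,∞) → ℝ that is differentiable with dū/dt(t,s) = g(ū(t,s)) for all t ≥ 0 and ū(0,s) = s; moreover the map (t,s) ↦ ū(t,s) is continuous on [0,∞)×ℝ. -/
open Set Filter

noncomputable section

/-- `u` is a forward solution on `[0,∞)` of the ODE `u' = g(u)` with `u(0) = s`. -/
def IsForwardSol (g : ℝ → ℝ) (s : ℝ) (u : ℝ → ℝ) : Prop :=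
  u 0 = s ∧ ∀ t ∈ Set.Ici (0:ℝ), HasDerivWithinAt u (g (u t)) (Set.Ici 0) t

/-- `g` is one-sided (right-) Lipschitz on every compact interval. -/
def OSLCompact (g : ℝ → ℝ) : Prop :=
  ∀ a b : ℝ, a < b → ∃ L : ℝ, ∀ w ∈ Set.Icc a b, ∀ z ∈ Set.Icc a b,
    w ≠ z → (g w - g z) / (w - z) ≤ L

/-- `limsup_{η → +∞} g(η)/η < ∞` and `limsup_{η → -∞} g(η)/η < ∞`. -/
def SublinearLimsup (g : ℝ → ℝ) : Prop :=
  (∃ C : ℝ, ∀ᶠ η in Filter.atTop, g η / η ≤ C) ∧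
  (∃ C : ℝ, ∀ᶠ η in Filter.atBot, g η / η ≤ C)

open Topology MeasureTheory in
lemma aux_sq_gronwall {w w' : ℝ → ℝ} {T K E : ℝ}
    (hw : ∀ t ∈ Icc (0:ℝ) T, HasDerivWithinAt w (w' t) (Icc 0 T) t)
    (hb : ∀ t ∈ Icc (0:ℝ) T, 2 * (w t * w' t) ≤ K * w t ^ 2 + E) (hK : 0 < K) (hE : 0 ≤ E) :
    ∀ t ∈ Icc (0:ℝ) T, w t ^ 2 ≤ (w 0 ^ 2 + E / K) * Real.exp (K * T) := by
  intro t ht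
  have hd : ∀ t ∈ Icc (0:ℝ) T,
      HasDerivWithinAt (fun t => w t ^ 2) (2 * (w t * w' t)) (Icc 0 T) t := by
    intro t ht
    have := (hw t ht).pow 2
    refine this.congr_deriv ?_
    simp; ring
  have h := le_gronwallBound_of_liminf_deriv_right_le (f := fun t => w t ^ 2)
    (f' := fun t => 2 * (w t * w' t)) (δ := w 0 ^ 2) (K := K) (ε := E) (a := 0) (b := T)
    (fun t ht => (hd t ht).continuousWithinAt)
    (fun x hx r hr => by
      have h1 : HasDerivWithinAt (fun t => w t ^ 2) (2 * (w x * w' x)) (Ici x) x :=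
        (hd x ⟨hx.1, hx.2.le⟩).mono_of_mem_nhdsWithin
          (Filter.mem_of_superset (Icc_mem_nhdsGE hx.2) (Icc_subset_Icc_left hx.1))
      exact h1.liminf_right_slope_le hr)
    le_rfl (fun x hx => hb x ⟨hx.1, hx.2.le⟩) t ht
  have h2 := gronwallBound_mono (δ := w 0 ^ 2) (sq_nonneg _) hE hK.le (by linarith [ht.2] : t - 0 ≤ T)
  have h3 := h.trans h2
  rw [gronwallBound_of_K_ne_0 hK.ne'] at h3
  have : 0 ≤ E / K := by positivity
  simp only at h3
  nlinarith

/-- Local solution predicate on `[0,T]`. -/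
def AuxSol (h : ℝ → ℝ) (T s : ℝ) (u : ℝ → ℝ) : Prop :=
  u 0 = s ∧ ∀ t ∈ Icc (0:ℝ) T, HasDerivWithinAt u (h (u t)) (Icc 0 T) t

open Topology MeasureTheory NNReal in
lemma aux_lip_exists {h : ℝ → ℝ} {K : ℝ≥0} (hK : LipschitzWith K h) {B : ℝ}
    (hB : ∀ x, |h x| ≤ B) {T : ℝ} (hT : 0 ≤ T) (s : ℝ) : ∃ u, AuxSol h T s u := by
  have hB0 : 0 ≤ B := (abs_nonneg _).trans (hB 0)
  have : IsPicardLindelof (fun _ => h) (⟨0, le_rfl, hT⟩ : Icc (0:ℝ) T) s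
      (⟨B * T, by positivity⟩ : ℝ≥0) 0 ⟨B, hB0⟩ K :=
    { lipschitzOnWith := fun _ _ => hK.lipschitzOnWith
      continuousOn := fun _ _ => continuousOn_const
      norm_le := fun _ _ x _ => hB x
      mul_max_le := by
        simp only [sub_zero, sub_self, max_eq_left hT, NNReal.coe_zero]
        exact le_rfl }
  obtain ⟨u, h1, h2⟩ := this.exists_eq_forall_mem_Icc_hasDerivWithinAt₀
  exact ⟨u, h1, h2⟩

/-- Stability for approximate solutions. -/
lemma aux_stab {h p q : ℝ → ℝ} {K ε T s r : ℝ} (hK : 0 ≤ K) (S : Set ℝ)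
    (hO : ∀ x ∈ S, ∀ y ∈ S, (x - y) * (h x - h y) ≤ K * (x - y) ^ 2)
    (hp : ∀ x ∈ S, |p x - h x| ≤ ε) (hq : ∀ x ∈ S, |q x - h x| ≤ ε) {u v : ℝ → ℝ}
    (hu : AuxSol p T s u) (hv : AuxSol q T r v)
    (huS : ∀ t ∈ Icc (0:ℝ) T, u t ∈ S) (hvS : ∀ t ∈ Icc (0:ℝ) T, v t ∈ S) :
    ∀ t ∈ Icc (0:ℝ) T, (u t - v t) ^ 2 ≤
      ((s - r) ^ 2 + 4 * ε ^ 2) * Real.exp ((2 * K + 1) * T) := by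
  intro t ht
  have h1 := aux_sq_gronwall (w := fun t => u t - v t) (w' := fun t => p (u t) - q (v t))
    (T := T) (K := 2 * K + 1) (E := 4 * ε ^ 2)
    (fun t ht => (hu.2 t ht).sub (hv.2 t ht)) (fun t ht => by
      have a1 := hO _ (huS t ht) _ (hvS t ht)
      have a2 := abs_le.1 (hp _ (huS t ht))
      have a3 := abs_le.1 (hq _ (hvS t ht))
      have a4 : ((p (u t) - h (u t)) - (q (v t) - h (v t))) ^ 2 ≤ (2 * ε) ^ 2 :=
        sq_le_sq' (by linarith) (by linarith)
      nlinarith [sq_nonneg ((u t - v t) - ((p (u t) - h (u t)) - (q (v t) - h (v t))))])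
    (by linarith) (by positivity) t ht
  refine h1.trans ?_
  rw [hu.1, hv.1]
  gcongr
  apply div_le_self (by positivity) (by linarith)

open Topology MeasureTheory NNReal in
/-- Existence for uniform limits of Lipschitz functions. -/
lemma aux_exists {h : ℝ → ℝ} (hc : Continuous h) {B K : ℝ} (hK : 0 ≤ K)
    (hB : ∀ x, |h x| ≤ B)
    (hO : ∀ x y, (x - y) * (h x - h y) ≤ K * (x - y) ^ 2)
    (hA : ∀ ε > (0:ℝ), ∃ (p : ℝ → ℝ) (C : ℝ≥0), LipschitzWith C p ∧ ∀ x, |p x - h x| ≤ ε)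
    {T : ℝ} (hT : 0 ≤ T) (s : ℝ) : ∃ u, AuxSol h T s u := by
  have hB0 : 0 ≤ B := (abs_nonneg _).trans (hB 0)
  have hε : ∀ n : ℕ, (0:ℝ) < 1 / (n + 1) := fun n => by positivity
  have hε1 : ∀ n : ℕ, (1:ℝ) / (n + 1) ≤ 1 := fun n => by
    rw [div_le_one (by positivity)]; simp
  choose p C hpL hpA using fun n : ℕ => hA _ (hε n)
  have hpB : ∀ n x, |p n x| ≤ B + 1 := fun n x => by
    have a1 := abs_le.1 (hpA n x)
    have a2 := abs_le.1 (hB x)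
    have := hε1 n
    exact abs_le.2 ⟨by linarith, by linarith⟩
  choose u hu using fun n => aux_lip_exists (hpL n) (hpB n) hT s
  -- Lipschitz
  have huL : ∀ n, LipschitzOnWith ⟨B + 1, by linarith⟩ (u n) (Icc 0 T) := fun n =>
    (convex_Icc 0 T).lipschitzOnWith_of_nnnorm_hasDerivWithin_le (hu n).2 (fun x hx => hpB n _)
  let c : ℝ → ℝ := fun t => projIcc 0 T hT t
  have hcm : ∀ t, c t ∈ Icc 0 T := fun t => (projIcc 0 T hT t).2
  have hcc : Continuous c := continuous_subtype_val.comp continuous_projIcc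
  have hce : ∀ t ∈ Icc 0 T, c t = t := fun t ht => by simp [c, projIcc_of_mem hT ht]
  -- Cauchy
  have hCau : ∀ t, CauchySeq (fun n => u n (c t)) := by
    intro t
    set M := Real.exp ((2 * K + 1) * T)
    refine cauchySeq_of_le_tendsto_0 (fun n : ℕ => Real.sqrt (4 * (1 / ((n:ℝ) + 1)) ^ 2 * M)) ?_ ?_
    · intro n m N hn hm
      have mono : ∀ {k : ℕ}, N ≤ k → (1:ℝ) / (k + 1) ≤ 1 / (N + 1) := fun hk => by
        apply one_div_le_one_div_of_le (by positivity)
        have : (N:ℝ) ≤ _ := Nat.cast_le.2 hk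
        linarith
      have := aux_stab hK univ (fun x _ y _ => hO x y) (fun x _ => (hpA n x).trans (mono hn))
        (fun x _ => (hpA m x).trans (mono hm)) (hu n) (hu m) (fun _ _ => mem_univ _)
        (fun _ _ => mem_univ _) (c t) (hcm t)
      rw [Real.dist_eq]
      apply Real.abs_le_sqrt
      simpa using this
    · have h0 := tendsto_one_div_add_atTop_nhds_zero_nat (𝕜 := ℝ)
      have := (((h0.pow 2).const_mul 4).mul_const M).sqrt
      simpa using this
  choose w hw using fun t => cauchySeq_tendsto_of_complete (hCau t)
  have hwc : Continuous w := by
    have : LipschitzWith ⟨B + 1, by linarith⟩ w := by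
      apply LipschitzWith.of_dist_le_mul
      intro x y
      have hxy : dist (c x) (c y) ≤ dist x y := by
        have := (LipschitzWith.projIcc hT).dist_le_mul x y
        rw [NNReal.coe_one, one_mul] at this
        exact this
      refine le_of_tendsto ((hw x).dist (hw y)) (Eventually.of_forall fun n => ?_)
      refine ((huL n).dist_le_mul _ (hcm x) _ (hcm y)).trans ?_
      exact mul_le_mul_of_nonneg_left hxy (NNReal.coe_nonneg _)
    exact this.continuous
  have hlim : ∀ t, Tendsto (fun n => p n (u n (c t))) atTop (𝓝 (h (w t))) := by
    intro t
    have h1 : Tendsto (fun n => h (u n (c t))) atTop (𝓝 (h (w t))) :=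
      (hc.tendsto _).comp (hw t)
    have h2 : Tendsto (fun n => p n (u n (c t)) - h (u n (c t))) atTop (𝓝 0) :=
      squeeze_zero_norm (fun n => hpA n _) (tendsto_one_div_add_atTop_nhds_zero_nat (𝕜 := ℝ))
    simpa using h2.add h1
  have hucont : ∀ n, Continuous fun t => u n (c t) := fun n =>
    (huL n).continuousOn.comp_continuous hcc hcm
  have hint : ∀ t ∈ Icc 0 T, w t = s + ∫ τ in (0:ℝ)..t, h (w τ) := by
    intro t ht
    have hn : ∀ n, u n (c t) = s + ∫ τ in (0:ℝ)..t, p n (u n (c τ)) := by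
      intro n
      have := intervalIntegral.integral_eq_sub_of_hasDerivAt_of_le (f := u n)
        (f' := fun τ => p n (u n (c τ))) ht.1
        ((huL n).continuousOn.mono (Icc_subset_Icc_right ht.2))
        (fun x hx => by
          have hx' : x ∈ Icc 0 T := ⟨hx.1.le, hx.2.le.trans ht.2⟩
          have := (hu n).2 x hx'
          simp only [hce x hx']
          exact this.hasDerivAt (Icc_mem_nhds hx.1 (hx.2.trans_le ht.2)))
        (((hpL n).continuous.comp (hucont n)).intervalIntegrable _ _)
      rw [this, (hu n).1, hce t ht]; ring
    have hl : Tendsto (fun n => s + ∫ τ in (0:ℝ)..t, p n (u n (c τ))) atTop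
        (𝓝 (s + ∫ τ in (0:ℝ)..t, h (w τ))) := by
      refine Tendsto.const_add _ ?_
      refine intervalIntegral.tendsto_integral_filter_of_dominated_convergence (fun _ => B + 1)
        (Eventually.of_forall fun n =>
          ((hpL n).continuous.comp (hucont n)).aestronglyMeasurable)
        (Eventually.of_forall fun n => Eventually.of_forall fun x _ => hpB n _)
        intervalIntegrable_const (Eventually.of_forall fun x _ => hlim x)
    exact tendsto_nhds_unique (hw t) (by simpa only [hn] using hl)
  refine ⟨w, ?_, ?_⟩
  · simpa using hint 0 ⟨le_rfl, hT⟩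
  · intro t ht
    have hd : HasDerivAt (fun t => s + ∫ τ in (0:ℝ)..t, h (w τ)) (h (w t)) t :=
      ((hc.comp hwc).integral_hasStrictDerivAt 0 t).hasDerivAt.const_add s
    exact hd.hasDerivWithinAt.congr hint (hint t ht)

lemma aux_growth {g : ℝ → ℝ} (hg : Continuous g) (hsub : SublinearLimsup g) :
    ∃ C D : ℝ, 0 ≤ C ∧ 0 ≤ D ∧ ∀ x, x * g x ≤ C * x ^ 2 + D := by
  obtain ⟨⟨C1, h1⟩, ⟨C2, h2⟩⟩ := hsub
  obtain ⟨a, ha⟩ := eventually_atTop.1 h1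
  obtain ⟨b, hb⟩ := eventually_atBot.1 h2
  set A := max (max a (-b)) 1
  have hA1 : 1 ≤ A := le_max_right _ _
  have hAa : a ≤ A := (le_max_left _ _).trans (le_max_left _ _)
  have hAb : -b ≤ A := (le_max_right _ _).trans (le_max_left _ _)
  obtain ⟨D, hD⟩ := (isCompact_Icc (a := -A) (b := A)).exists_bound_of_continuousOn
    (f := fun x => x * g x) (by fun_prop)
  have hq : ∀ {x C : ℝ}, x ≠ 0 → g x / x ≤ C → x * g x ≤ C * x ^ 2 := by
    intro x C hx h
    have h3 := mul_le_mul_of_nonneg_right h (sq_nonneg x)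
    have : g x / x * x ^ 2 = x * g x := by field_simp
    linarith
  have hC1 : 0 ≤ |C1| + |C2| := by positivity
  have hD0 : 0 ≤ |D| := abs_nonneg _
  refine ⟨|C1| + |C2|, |D|, hC1, hD0, fun x => ?_⟩
  have p1 := le_abs_self C1
  have p2 := le_abs_self C2
  have p3 := abs_nonneg C1
  have p4 := abs_nonneg C2
  have p5 := le_abs_self D
  rcases le_or_gt A x with hx | hx
  · have := hq (by linarith) (ha x (by linarith))
    nlinarith [sq_nonneg x]
  rcases le_or_gt x (-A) with hx' | hx'
  · have := hq (by linarith) (hb x (by linarith))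
    nlinarith [sq_nonneg x]
  · have := hD x ⟨hx'.le, hx.le⟩
    have := (abs_le.1 (show |x * g x| ≤ D from this)).2
    nlinarith [sq_nonneg x]

lemma aux_bound {C D : ℝ} (hC : 0 ≤ C) (hD : 0 ≤ D) (T R : ℝ) :
    ∃ M : ℝ, 1 ≤ M ∧ ∀ (h : ℝ → ℝ) (s : ℝ) (u : ℝ → ℝ), |s| ≤ R →
      (∀ x, x * h x ≤ C * x ^ 2 + D) → AuxSol h T s u → ∀ t ∈ Icc (0:ℝ) T, u t ∈ Icc (-M) M := by
  set Q := (R ^ 2 + 2 * D / (2 * C + 1)) * Real.exp ((2 * C + 1) * T)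
  refine ⟨1 + Real.sqrt Q, by linarith [Real.sqrt_nonneg Q], ?_⟩
  intro h s u hs hh hu t ht
  have h1 := aux_sq_gronwall (K := 2 * C + 1) (E := 2 * D) hu.2
    (fun t _ => by nlinarith [hh (u t), sq_nonneg (u t)]) (by linarith) (by linarith) t ht
  rw [hu.1] at h1
  have h2 : u t ^ 2 ≤ Q := by
    refine h1.trans ?_
    have : s ^ 2 ≤ R ^ 2 := sq_le_sq' (by linarith [(abs_le.1 hs).1]) (abs_le.1 hs).2
    exact mul_le_mul_of_nonneg_right (by linarith) (Real.exp_pos _).le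
  have h3 := abs_le.1 (Real.abs_le_sqrt h2)
  exact ⟨by linarith [h3.1], by linarith [h3.2]⟩

lemma aux_osl {g : ℝ → ℝ} (hOSL : OSLCompact g) {M : ℝ} (hM : 1 ≤ M) :
    ∃ K : ℝ, 0 ≤ K ∧ ∀ x ∈ Icc (-M) M, ∀ y ∈ Icc (-M) M,
      (x - y) * (g x - g y) ≤ K * (x - y) ^ 2 := by
  obtain ⟨L, hL⟩ := hOSL (-M) M (by linarith)
  refine ⟨max L 0, le_max_right _ _, fun x hx y hy => ?_⟩
  by_cases hxy : x = y
  · simp [hxy]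
  have h1 := (hL x hx y hy hxy).trans (le_max_left L 0)
  have h3 := mul_le_mul_of_nonneg_right h1 (sq_nonneg (x - y))
  have h4 : x - y ≠ 0 := sub_ne_zero.2 hxy
  have : (g x - g y) / (x - y) * (x - y) ^ 2 = (x - y) * (g x - g y) := by field_simp
  linarith

lemma aux_stability {g : ℝ → ℝ} (hg : Continuous g) (hOSL : OSLCompact g)
    (hsub : SublinearLimsup g) (T R : ℝ) :
    ∃ Λ : ℝ, ∀ s r u v, |s| ≤ R → |r| ≤ R → AuxSol g T s u → AuxSol g T r v →
      ∀ t ∈ Icc (0:ℝ) T, |u t - v t| ≤ Λ * |s - r| := by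
  obtain ⟨C, D, hC, hD, hgr⟩ := aux_growth hg hsub
  obtain ⟨M, hM, hb⟩ := aux_bound hC hD T R
  obtain ⟨K, hK, hO⟩ := aux_osl hOSL hM
  refine ⟨Real.sqrt (Real.exp ((2 * K + 1) * T)), fun s r u v hs hr hu hv t ht => ?_⟩
  have h1 := aux_stab (ε := 0) hK (Icc (-M) M) hO (fun x _ => by simp) (fun x _ => by simp) hu hv
    (hb g s u hs hgr hu) (hb g r v hr hgr hv) t ht
  have h2 := Real.abs_le_sqrt h1
  refine h2.trans (le_of_eq ?_)
  rw [show ((s - r) ^ 2 + 4 * (0:ℝ) ^ 2) * Real.exp ((2 * K + 1) * T)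
    = Real.exp ((2 * K + 1) * T) * (s - r) ^ 2 by ring,
    Real.sqrt_mul (Real.exp_pos _).le, Real.sqrt_sq_eq_abs]

open NNReal in
lemma aux_local_exists {g : ℝ → ℝ} (hg : Continuous g) (hOSL : OSLCompact g)
    (hsub : SublinearLimsup g) {T : ℝ} (hT : 0 ≤ T) (s : ℝ) : ∃ u, AuxSol g T s u := by
  obtain ⟨C, D, hC, hD, hgr⟩ := aux_growth hg hsub
  obtain ⟨M, hM, hb⟩ := aux_bound (C := C + D) (D := D) (by linarith) hD T |s|
  obtain ⟨K, hK, hO⟩ := aux_osl hOSL hM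
  have hMM : -M ≤ M := by linarith
  let P : ℝ → ℝ := fun x => projIcc (-M) M hMM x
  have hPm : ∀ x, P x ∈ Icc (-M) M := fun x => (projIcc (-M) M hMM x).2
  have hPc : Continuous P := continuous_subtype_val.comp continuous_projIcc
  have hPe : ∀ x ∈ Icc (-M) M, P x = x := fun x hx => by simp [P, projIcc_of_mem hMM hx]
  have hPL : LipschitzWith 1 P := by
    have := (LipschitzWith.subtype_val (Icc (-M) M)).comp (LipschitzWith.projIcc hMM)
    rw [one_mul] at this
    exact this
  have hPmono : ∀ x y, y ≤ x → P y ≤ P x := fun x y h => monotone_projIcc hMM h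
  obtain ⟨B, hB⟩ := (isCompact_Icc (a := -M) (b := M)).exists_bound_of_continuousOn
    hg.continuousOn
  have hO1 : ∀ x y, y ≤ x → (x - y) * (g (P x) - g (P y)) ≤ K * (x - y) ^ 2 := by
    intro x y hxy
    have e0 := hPmono x y hxy
    have e1 : P x - P y ≤ x - y := by
      have := hPL.dist_le_mul x y
      rw [Real.dist_eq, Real.dist_eq, abs_of_nonneg (by linarith : 0 ≤ x - y),
        abs_of_nonneg (by linarith : 0 ≤ P x - P y)] at this
      simpa using this
    rcases e0.eq_or_lt with e | e
    · rw [e]; simp only [sub_self, mul_zero]; positivity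
    · have h1 := hO _ (hPm x) _ (hPm y)
      have h2 : g (P x) - g (P y) ≤ K * (P x - P y) := by
        have : 0 < P x - P y := by linarith
        refine le_of_mul_le_mul_left ?_ this
        linarith
      have h3 : K * (P x - P y) ≤ K * (x - y) := mul_le_mul_of_nonneg_left e1 hK
      have := mul_le_mul_of_nonneg_left (h2.trans h3) (by linarith : 0 ≤ x - y)
      linarith
  obtain ⟨u, hu⟩ := aux_exists (h := fun x => g (P x)) (hg.comp hPc) (B := B) hK
    (fun x => hB _ (hPm x))
    (fun x y => by
      rcases le_total y x with h | h
      · exact hO1 x y h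
      · have := hO1 y x h
        linarith)
    (fun ε hε => by
      obtain ⟨p, hp⟩ := exists_polynomial_near_of_continuousOn (-M) M g hg.continuousOn ε hε
      have hcd : ContDiff ℝ 1 (fun x => p.eval x) := by
        simpa using p.contDiff_aeval (𝕜 := ℝ) 1
      obtain ⟨N, hN⟩ := hcd.locallyLipschitz.locallyLipschitzOn.exists_lipschitzOnWith_of_compact
        (isCompact_Icc (a := -M) (b := M))
      refine ⟨fun x => p.eval (P x), N * 1, ?_, fun x => (hp _ (hPm x)).le⟩
      rw [← lipschitzOnWith_univ]
      exact hN.comp hPL.lipschitzOnWith (fun x _ => hPm x))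
    hT s
  have hgrP : ∀ x, x * g (P x) ≤ (C + D) * x ^ 2 + D := by
    intro x
    have hDx : 0 ≤ D * x ^ 2 := by positivity
    rcases le_or_gt x (-M) with hx | hx
    · have hPx : P x = -M := by simp [P, projIcc_of_le_left hMM hx]
      rw [hPx]
      have h1 := hgr (-M)
      have h2 : -g (-M) ≤ C * M + D := by
        refine le_of_mul_le_mul_left ?_ (by linarith : 0 < M)
        nlinarith
      have h3 := mul_le_mul_of_nonneg_left h2 (by linarith : 0 ≤ -x)
      have h4 : -x * M ≤ x ^ 2 := by nlinarith
      have h5 : -x ≤ x ^ 2 := by nlinarith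
      nlinarith [mul_le_mul_of_nonneg_left h4 hC, mul_le_mul_of_nonneg_left h5 hD]
    rcases le_or_gt M x with hx' | hx'
    · have hPx : P x = M := by simp [P, projIcc_of_right_le hMM hx']
      rw [hPx]
      have h1 := hgr M
      have h2 : g M ≤ C * M + D := by
        refine le_of_mul_le_mul_left ?_ (by linarith : 0 < M)
        nlinarith
      have h3 := mul_le_mul_of_nonneg_left h2 (by linarith : 0 ≤ x)
      have h4 : x * M ≤ x ^ 2 := by nlinarith
      have h5 : x ≤ x ^ 2 := by nlinarith
      nlinarith [mul_le_mul_of_nonneg_left h4 hC, mul_le_mul_of_nonneg_left h5 hD]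
    · rw [hPe x ⟨hx.le, hx'.le⟩]
      linarith [hgr x]
  have hin := hb _ s u le_rfl hgrP hu
  refine ⟨u, hu.1, fun t ht => ?_⟩
  have := hu.2 t ht
  simp only [hPe _ (hin t ht)] at this
  exact this

lemma AuxSol.restrict {h : ℝ → ℝ} {T T' s : ℝ} {u : ℝ → ℝ} (hu : AuxSol h T s u) (hT : T' ≤ T) :
    AuxSol h T' s u :=
  ⟨hu.1, fun t ht => (hu.2 t ⟨ht.1, ht.2.trans hT⟩).mono (Icc_subset_Icc_right hT)⟩

lemma IsForwardSol.auxSol {h : ℝ → ℝ} {s : ℝ} {u : ℝ → ℝ} (hu : IsForwardSol h s u) (T : ℝ) :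
    AuxSol h T s u :=
  ⟨hu.1, fun t ht => (hu.2 t ht.1).mono Icc_subset_Ici_self⟩

/-- well-posedness of the characteristic ODE, Lemma 2.5 of the paper.
If `g` is continuous, one-sided Lipschitz on every compact interval, and sublinear at
`±∞` in the limsup sense, then for every `s ∈ ℝ` the initial value problem
`dū/dt = g(ū)`, `ū(0) = s` has a unique forward solution on `[0,∞)`, and the map
`(t,s) ↦ ū(t,s)` is continuous on `[0,∞) × ℝ`. -/
theorem characteristic_ODE_wellposed
    (g : ℝ → ℝ) (hg : Continuous g) (hOSL : OSLCompact g) (hsub : SublinearLimsup g) :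
    ∃ ub : ℝ → ℝ → ℝ,
      (∀ s : ℝ, IsForwardSol g s (fun t => ub t s)) ∧
      (∀ s : ℝ, ∀ v : ℝ → ℝ, IsForwardSol g s v → ∀ t ≥ (0:ℝ), v t = ub t s) ∧
      ContinuousOn (fun p : ℝ × ℝ => ub p.1 p.2) (Set.Ici 0 ×ˢ (Set.univ : Set ℝ)) := by

  have hex : ∀ (n : ℕ) (s : ℝ), ∃ u, AuxSol g n s u := fun n s =>
    aux_local_exists hg hOSL hsub (Nat.cast_nonneg n) s
  choose U hU using hex
  have huniq : ∀ (T s : ℝ) (u v : ℝ → ℝ), AuxSol g T s u → AuxSol g T s v →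
      ∀ t ∈ Icc (0:ℝ) T, u t = v t := by
    intro T s u v hu hv t ht
    obtain ⟨Λ, hΛ⟩ := aux_stability hg hOSL hsub T |s|
    have := hΛ s s u v le_rfl le_rfl hu hv t ht
    simp only [sub_self, abs_zero, mul_zero] at this
    exact sub_eq_zero.1 (abs_nonpos_iff.1 this)
  let ub : ℝ → ℝ → ℝ := fun t s => U (⌈t⌉₊ + 1) s t
  have hub : ∀ (n : ℕ) (t s : ℝ), t ∈ Icc (0:ℝ) n → ub t s = U n s t := by
    intro n t s ht
    have h1 : t ≤ ((⌈t⌉₊ + 1 : ℕ) : ℝ) := by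
      push_cast; linarith [Nat.le_ceil t]
    exact huniq t s _ _ ((hU _ s).restrict h1) ((hU n s).restrict ht.2) t ⟨ht.1, le_rfl⟩
  have hubS : ∀ (n : ℕ) (s : ℝ), AuxSol g n s (fun t => ub t s) := by
    intro n s
    refine ⟨(hub n 0 s ⟨le_rfl, Nat.cast_nonneg n⟩).trans (hU n s).1, fun t ht => ?_⟩
    simp only [hub n t s ht]
    exact ((hU n s).2 t ht).congr (fun x hx => hub n x s hx) (hub n t s ht)
  have hfwd : ∀ s : ℝ, IsForwardSol g s (fun t => ub t s) := by
    intro s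
    refine ⟨(hubS 0 s).1, fun t ht => ?_⟩
    obtain ⟨n, hn⟩ := exists_nat_gt t
    refine ((hubS n s).2 t ⟨ht, hn.le⟩).mono_of_mem_nhdsWithin ?_
    rw [← Ici_inter_Iic]
    exact inter_mem self_mem_nhdsWithin (mem_nhdsWithin_of_mem_nhds (Iic_mem_nhds hn))
  refine ⟨ub, hfwd, ?_, ?_⟩
  · intro s v hv t ht
    exact huniq t s _ _ (hv.auxSol t) ((hfwd s).auxSol t) t ⟨ht, le_rfl⟩
  · rintro ⟨t₀, s₀⟩ ⟨ht₀, -⟩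
    obtain ⟨n, hn⟩ := exists_nat_gt t₀
    obtain ⟨Λ, hΛ⟩ := aux_stability hg hOSL hsub n (|s₀| + 1)
    rw [ContinuousWithinAt, tendsto_iff_dist_tendsto_zero]
    set F := nhdsWithin (t₀, s₀) (Ici (0:ℝ) ×ˢ (univ : Set ℝ)) with hF
    have hfst : Tendsto (fun p : ℝ × ℝ => p.1) F (nhdsWithin t₀ (Ici 0)) := by
      refine tendsto_nhdsWithin_iff.2 ⟨continuous_fst.continuousWithinAt, ?_⟩
      filter_upwards [self_mem_nhdsWithin] with p hp using hp.1
    have hsnd : Tendsto (fun p : ℝ × ℝ => p.2) F (nhds s₀) :=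
      continuous_snd.continuousWithinAt
    have hc : Tendsto (fun p : ℝ × ℝ => ub p.1 s₀) F (nhds (ub t₀ s₀)) :=
      Tendsto.comp (((hfwd s₀).2 t₀ ht₀).continuousWithinAt) hfst
    have hlim : Tendsto (fun p : ℝ × ℝ => Λ * dist p.2 s₀ + dist (ub p.1 s₀) (ub t₀ s₀)) F
        (nhds 0) := by
      have := ((tendsto_iff_dist_tendsto_zero.1 hsnd).const_mul Λ).add
        (tendsto_iff_dist_tendsto_zero.1 hc)
      simpa using this
    refine squeeze_zero' (Eventually.of_forall fun _ => dist_nonneg) ?_ hlim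
    have e1 : ∀ᶠ p in F, p.1 ∈ Icc (0:ℝ) n := by
      refine hfst.eventually ?_
      filter_upwards [self_mem_nhdsWithin, mem_nhdsWithin_of_mem_nhds (Iic_mem_nhds hn)]
        with x h1 h2 using ⟨h1, h2⟩
    have e2 : ∀ᶠ p in F, |p.2| ≤ |s₀| + 1 := by
      have : ∀ᶠ p in F, |p.2| < |s₀| + 1 :=
        hsnd.abs.eventually_lt_const (by linarith)
      filter_upwards [this] with p hp using hp.le
    filter_upwards [e1, e2] with p h1 h2
    refine (dist_triangle _ (ub p.1 s₀) _).trans ?_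
    gcongr
    exact hΛ p.2 s₀ _ _ h2 (by linarith) (hubS n p.2) (hubS n s₀) p.1 h1
end
end

section
/- Let g : ℝ → ℝ be continuous and let a < b and L be such that (g(w) − g(z))/(w − z) ≤ L for all w ≠ z in [a,b]. Suppose u, v : [0,T] → ℝ are differentiable with values in [a,b], u'(t) = g(u(t)) and v'(t) = g(v(t)) for all t ∈ [0,T], and u(0) ≤ v(0). Then for every t ∈ [0,T], 0 ≤ v(t) − u(t) ≤ (v(0) − u(0)) e^{Lt}. In particular, solutions of the autonomous ODE with a one-sided Lipschitz right-hand side are nondecreasing and Lipschitz continuous functions of their initial value. -/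
open Set Filter

noncomputable section

/-- one-sided Lipschitz comparison/contraction estimate.
If `g` is continuous and one-sided Lipschitz with constant `L` on `[a,b]`, and
`u, v : [0,T] → ℝ` are differentiable solutions of the autonomous ODE `w' = g(w)` with
values in `[a,b]` and `u(0) ≤ v(0)`, then for every `t ∈ [0,T]`,
`0 ≤ v(t) - u(t) ≤ (v(0) - u(0)) e^{L t}`: solutions are nondecreasing and Lipschitz
continuous functions of their initial value. -/
theorem osl_comparison_estimate
    (g : ℝ → ℝ) (hg : Continuous g)
    (a b L : ℝ) (hab : a < b)
    (hOSL : ∀ w ∈ Set.Icc a b, ∀ z ∈ Set.Icc a b, w ≠ z → (g w - g z) / (w - z) ≤ L)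
    (T : ℝ) (hT : 0 ≤ T)
    (u v : ℝ → ℝ)
    (hurange : ∀ t ∈ Set.Icc 0 T, u t ∈ Set.Icc a b)
    (hvrange : ∀ t ∈ Set.Icc 0 T, v t ∈ Set.Icc a b)
    (hu : ∀ t ∈ Set.Icc (0:ℝ) T, HasDerivWithinAt u (g (u t)) (Set.Icc 0 T) t)
    (hv : ∀ t ∈ Set.Icc (0:ℝ) T, HasDerivWithinAt v (g (v t)) (Set.Icc 0 T) t)
    (h0 : u 0 ≤ v 0) :
    ∀ t ∈ Set.Icc (0:ℝ) T,
      0 ≤ v t - u t ∧ v t - u t ≤ (v 0 - u 0) * Real.exp (L * t) := by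
  have hmul : ∀ w ∈ Set.Icc a b, ∀ z ∈ Set.Icc a b,
      (w - z) * (g w - g z) ≤ L * (w - z) ^ 2 := by
    intro w hw z hz
    by_cases h : w = z
    · subst h; simp
    · have h1 := hOSL w hw z hz h
      have h2 : w - z ≠ 0 := sub_ne_zero.mpr h
      have h3 := mul_le_mul_of_nonneg_right h1 (sq_nonneg (w - z))
      have h4 : (g w - g z) / (w - z) * (w - z) ^ 2 = (w - z) * (g w - g z) := by
        field_simp
      linarith
  have hd : ∀ t ∈ Set.Icc (0:ℝ) T, HasDerivWithinAt
      (fun t => ((v t - u t) * Real.exp (-(L * t))) ^ 2)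
      (2 * ((v t - u t) * (g (v t) - g (u t)) - L * (v t - u t) ^ 2)
        * Real.exp (-(L * t)) ^ 2) (Set.Icc 0 T) t := by
    intro t ht
    have he : HasDerivWithinAt (fun t : ℝ => Real.exp (-(L * t)))
        (Real.exp (-(L * t)) * (-(L * 1))) (Set.Icc 0 T) t :=
      (((hasDerivAt_id t).const_mul L).neg.exp).hasDerivWithinAt
    have := (((hv t ht).sub (hu t ht)).mul he).pow 2
    refine this.congr_deriv ?_
    simp
    ring
  have hanti : AntitoneOn (fun t => ((v t - u t) * Real.exp (-(L * t))) ^ 2)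
      (Set.Icc 0 T) := by
    refine antitoneOn_of_hasDerivWithinAt_nonpos (convex_Icc 0 T)
      (fun t ht => (hd t ht).continuousWithinAt)
      (fun t ht => (hd t (interior_subset ht)).mono interior_subset) ?_
    intro t ht
    have ht' := interior_subset ht
    have h := hmul _ (hvrange t ht') _ (hurange t ht')
    exact mul_nonpos_of_nonpos_of_nonneg (by linarith) (sq_nonneg _)
  intro t ht
  constructor
  · by_contra hneg
    push Not at hneg
    have hsub : Set.Icc 0 t ⊆ Set.Icc 0 T := Set.Icc_subset_Icc_right ht.2
    have hc : ContinuousOn (fun t => v t - u t) (Set.Icc 0 t) := fun s hs =>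
      (((hv s (hsub hs)).sub (hu s (hsub hs))).continuousWithinAt).mono hsub
    obtain ⟨s, hs, hs0⟩ := intermediate_value_Icc' ht.1 hc
      (show (0:ℝ) ∈ Set.Icc (v t - u t) (v 0 - u 0) from ⟨hneg.le, by linarith⟩)
    have h := hanti (hsub hs) ht hs.2
    simp only at h hs0
    rw [hs0] at h
    have : 0 < ((v t - u t) * Real.exp (-(L * t))) ^ 2 :=
      sq_pos_iff.mpr (mul_ne_zero hneg.ne (Real.exp_pos _).ne')
    rw [zero_mul] at h
    linarith [zero_pow (M₀ := ℝ) (two_ne_zero)]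
  · have h := hanti (show (0:ℝ) ∈ Set.Icc 0 T from ⟨le_rfl, hT⟩) ht ht.1
    simp only [mul_zero, neg_zero, Real.exp_zero, mul_one] at h
    have h1 := abs_le_of_sq_le_sq' h (by linarith)
    have h2 := mul_le_mul_of_nonneg_right h1.2 (Real.exp_pos (L * t)).le
    rwa [mul_assoc, ← Real.exp_add, neg_add_cancel, Real.exp_zero, mul_one] at h2
end
end
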